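/- arXiv:math/0406250 — 2 statements merged into one kernel-verified Lean document; each statement's English description precedes it below -/
import Mathlib

section
/- Let μ ⊆ λ be partitions and let λ′ and μ′ denote their conjugate partitions, with at most l parts each. Then s_{λ/μ} = det(e_{λ′_i − μ′_j − i + j})_{1 ≤ i,j ≤ l}, where e_r denotes the elementary symmetric function of degree r (the sum of all squarefree monomials of degree r in x_1, x_2, …), with e_0 = 1 and e_r = 0 for r < 0. -/
noncomputable section

/-- A box in the plane: `(row, column)`, rows increasing downward (English notation). -/
abbrev Box : Type := ℤ × ℤ

/-- The content of a box `(i, j)` is `j - i`. -/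
def boxContent (b : Box) : ℤ := b.2 - b.1

/-- An integer partition, indexed from `1` (the value `part 0` is irrelevant). -/
structure Partition' where
  part : ℕ → ℕ
  antitone : ∀ ⦃i j : ℕ⦄, i ≤ j → part j ≤ part i
  eventually_zero : ∃ N : ℕ, ∀ i : ℕ, N ≤ i → part i = 0

/-- The skew diagram `λ/μ`: boxes `(i, j)` with `i ≥ 1` and `μ_i < j ≤ λ_i`. -/
def skewCells (lam mu : Partition') : Set Box :=
  {b : Box | 1 ≤ b.1 ∧ (mu.part b.1.toNat : ℤ) < b.2 ∧ b.2 ≤ (lam.part b.1.toNat : ℤ)}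

/-- `D` is the set of boxes of a skew diagram `λ/μ` for some partitions `μ ⊆ λ`. -/
def IsSkewShape (D : Set Box) : Prop :=
  ∃ lam mu : Partition', (∀ i, mu.part i ≤ lam.part i) ∧ D = skewCells lam mu

/-- Translate a set of boxes by a vector `v`. -/
def boxTranslate (v : Box) (D : Set Box) : Set Box := (fun b => b + v) '' D

/-- `D` is a translate of a skew diagram. -/
def IsSkewLike (D : Set Box) : Prop := ∃ v : Box, IsSkewShape (boxTranslate v D)

/-- Two boxes share a common edge. -/
def boxAdj (a b : Box) : Prop :=
  (a.1 = b.1 ∧ (a.2 = b.2 + 1 ∨ b.2 = a.2 + 1)) ∨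
  (a.2 = b.2 ∧ (a.1 = b.1 + 1 ∨ b.1 = a.1 + 1))

/-- Any two boxes of `D` are joined by a path of boxes of `D` in which consecutive
boxes share a common edge. -/
def EdgewiseConnected (D : Set Box) : Prop :=
  ∀ a ∈ D, ∀ b ∈ D, Relation.ReflTransGen (fun x y => x ∈ D ∧ y ∈ D ∧ boxAdj x y) a b

/-- `D` contains no `2 × 2` block of boxes. -/
def NoTwoByTwo (D : Set Box) : Prop :=
  ∀ b : Box, ¬(b ∈ D ∧ (b.1, b.2 + 1) ∈ D ∧ (b.1 + 1, b.2) ∈ D ∧ (b.1 + 1, b.2 + 1) ∈ D)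

/-- A border strip (ribbon): a nonempty edgewise connected skew diagram (up to translation)
containing no `2 × 2` block of boxes. -/
def IsBorderStrip (B : Set Box) : Prop :=
  B.Nonempty ∧ IsSkewLike B ∧ EdgewiseConnected B ∧ NoTwoByTwo B

/-- `b` is the starting box (lower-left end) of `B`: no box of `B` directly to its left
nor directly below it. -/
def IsStartBox (B : Set Box) (b : Box) : Prop :=
  b ∈ B ∧ (b.1, b.2 - 1) ∉ B ∧ (b.1 + 1, b.2) ∉ B

/-- `b` is the ending box (upper-right end) of `B`: no box of `B` directly above it
nor directly to its right. -/
def IsEndBox (B : Set Box) (b : Box) : Prop :=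
  b ∈ B ∧ (b.1 - 1, b.2) ∉ B ∧ (b.1, b.2 + 1) ∉ B

/-- The strip `B` has starting box of content `p` and ending box of content `q`. -/
def HasPQ (B : Set Box) (p q : ℤ) : Prop :=
  (∃ b : Box, IsStartBox B b ∧ boxContent b = p) ∧
  (∃ b : Box, IsEndBox B b ∧ boxContent b = q)

/-- An outside decomposition of `D`: a partition of the boxes of `D` into pairwise disjoint
border strips, each strip having its starting box on the left or bottom perimeter of `D` and
its ending box on the right or top perimeter of `D`. -/
def IsOutsideDecomposition (D : Set Box) (P : Set (Set Box)) : Prop :=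
  (∀ θ ∈ P, IsBorderStrip θ ∧ θ ⊆ D) ∧
  (∀ b ∈ D, ∃! θ : Set Box, θ ∈ P ∧ b ∈ θ) ∧
  (∀ θ ∈ P, ∀ b : Box, IsStartBox θ b → ((b.1, b.2 - 1) ∉ D ∨ (b.1 + 1, b.2) ∉ D)) ∧
  (∀ θ ∈ P, ∀ b : Box, IsEndBox θ b → ((b.1 - 1, b.2) ∉ D ∨ (b.1, b.2 + 1) ∉ D))

/-- The box `b` of `D` goes up in the outside decomposition `P`: in the strip of `P`
containing it, the next box is directly above it; an ending box goes up when no box of `D`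
lies directly above it. -/
def GoesUp (D : Set Box) (P : Set (Set Box)) (b : Box) : Prop :=
  ∃ θ ∈ P, b ∈ θ ∧ ((b.1 - 1, b.2) ∈ θ ∨ (IsEndBox θ b ∧ (b.1 - 1, b.2) ∉ D))

/-- The box `b` of `D` goes right in the outside decomposition `P`: in the strip of `P`
containing it, the next box is directly to its right; an ending box goes right when some box
of `D` lies directly above it. -/
def GoesRight (D : Set Box) (P : Set (Set Box)) (b : Box) : Prop :=
  ∃ θ ∈ P, b ∈ θ ∧ ((b.1, b.2 + 1) ∈ θ ∨ (IsEndBox θ b ∧ (b.1 - 1, b.2) ∈ D))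

/-- `T` is a cutting strip of the outside decomposition `P` of `D`: a border strip whose
boxes are labeled by the contents of `D` (each content appearing once), in which the box
labeled `c` goes up or goes right according as the boxes of the diagonal of content `c`
of `D` go up or go right in `P`. -/
def IsCuttingStripOf (D : Set Box) (P : Set (Set Box)) (T : Set Box) : Prop :=
  IsBorderStrip T ∧ boxContent '' T = boxContent '' D ∧
  ∀ b ∈ T, ∀ c ∈ D, boxContent c = boxContent b →
    (((b.1 - 1, b.2) ∈ T → GoesUp D P c) ∧ ((b.1, b.2 + 1) ∈ T → GoesRight D P c))

/-- The segment `φ[p, q]` of a strip `T`: its boxes of content between `p` and `q`. -/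
def stripSegment (T : Set Box) (p q : ℤ) : Set Box :=
  {b ∈ T | p ≤ boxContent b ∧ boxContent b ≤ q}

/-- The box of content `c` of the strip `T` goes up (the next box is directly above it). -/
def StripGoesUpAt (T : Set Box) (c : ℤ) : Prop :=
  ∃ b ∈ T, boxContent b = c ∧ (b.1 - 1, b.2) ∈ T

/-- The box of content `c` of the strip `T` goes right (the next box is directly right of it). -/
def StripGoesRightAt (T : Set Box) (c : ℤ) : Prop :=
  ∃ b ∈ T, boxContent b = c ∧ (b.1, b.2 + 1) ∈ T

/-- `T'` is obtained from the strip `T` by reversing the direction (up versus right) of the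
box labeled `i`, keeping the directions of all other boxes. -/
def IsTwist (i : ℤ) (T T' : Set Box) : Prop :=
  boxContent '' T' = boxContent '' T ∧
  (∀ c : ℤ, c ≠ i → (StripGoesUpAt T c ↔ StripGoesUpAt T' c)) ∧
  (StripGoesUpAt T i ↔ StripGoesRightAt T' i)

/-- The inversion number of an outside decomposition: the number of ordered pairs of
strips `(θ₁, θ₂)` with `p(θ₁) > p(θ₂)` and `q(θ₁) < q(θ₂)`. -/
def invOD (P : Set (Set Box)) : ℕ :=
  {θθ : Set Box × Set Box | θθ.1 ∈ P ∧ θθ.2 ∈ P ∧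
    ∃ p₁ q₁ p₂ q₂ : ℤ, HasPQ θθ.1 p₁ q₁ ∧ HasPQ θθ.2 p₂ q₂ ∧ p₂ < p₁ ∧ q₁ < q₂}.ncard

/-- A semistandard Young tableau of shape `D`: entries (variable indices) weakly increase
along rows and strictly increase down columns; entries outside `D` are normalized to `0`. -/
def IsSSYT (D : Set Box) (T : Box → ℕ) : Prop :=
  (∀ b ∈ D, (b.1, b.2 + 1) ∈ D → T b ≤ T (b.1, b.2 + 1)) ∧
  (∀ b ∈ D, (b.1 + 1, b.2) ∈ D → T b < T (b.1 + 1, b.2)) ∧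
  (∀ b : Box, b ∉ D → T b = 0)

/-- The skew Schur function of a skew diagram `D`, as a formal power series in the
variables `x_n` (`n : ℕ`): the coefficient of a monomial `μ` is the number of semistandard
Young tableaux of shape `D` using each variable `n` exactly `μ n` times. -/
def schur (D : Set Box) : MvPowerSeries ℕ ℤ :=
  fun μ => ({T : Box → ℕ | IsSSYT D T ∧ ∀ n : ℕ, μ n = {b ∈ D | T b = n}.ncard}.ncard : ℤ)

/-- `b` is the upper-right corner box of `D`: the rightmost box of the top row. -/
def IsUpperRightCorner (D : Set Box) (b : Box) : Prop :=
  b ∈ D ∧ (∀ c ∈ D, b.1 ≤ c.1) ∧ ∀ c ∈ D, c.1 = b.1 → c.2 ≤ b.2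

/-- `b` is the lower-left corner box of `D`: the leftmost box of the bottom row. -/
def IsLowerLeftCorner (D : Set Box) (b : Box) : Prop :=
  b ∈ D ∧ (∀ c ∈ D, c.1 ≤ b.1) ∧ ∀ c ∈ D, c.1 = b.1 → b.2 ≤ c.2

/-- The block (edgewise connected component) of `D` containing the box `a`. -/
def blockOf (D : Set Box) (a : Box) : Set Box :=
  {b : Box | Relation.ReflTransGen (fun x y => x ∈ D ∧ y ∈ D ∧ boxAdj x y) a b}

/-- The complete homogeneous symmetric function `h_r` (`h_0 = 1`, `h_r = 0` for `r < 0`):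
the sum of all monomials of degree `r`. -/
def hSym (r : ℤ) : MvPowerSeries ℕ ℤ :=
  fun μ => if ((μ.sum fun _ e => e : ℕ) : ℤ) = r then 1 else 0

/-- The elementary symmetric function `e_r` (`e_0 = 1`, `e_r = 0` for `r < 0`):
the sum of all squarefree monomials of degree `r`. -/
def eSym (r : ℤ) : MvPowerSeries ℕ ℤ :=
  fun μ => if (∀ n ∈ μ.support, μ n = 1) ∧ ((μ.sum fun _ e => e : ℕ) : ℤ) = r then 1 else 0

/-- The `j`-th part (`j ≥ 1`) of the conjugate partition: the number of indices `i ≥ 1`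
with `λ_i ≥ j`. -/
def conjPart (lam : Partition') (j : ℕ) : ℕ := {i : ℕ | 1 ≤ i ∧ j ≤ lam.part i}.ncard

/-- The order on the supersymmetric alphabet `x_0 < x_1 < ⋯ < y_0 < y_1 < ⋯`,
with `Sum.inl n` representing `x_n` and `Sum.inr n` representing `y_n`. -/
def entryLE : ℕ ⊕ ℕ → ℕ ⊕ ℕ → Prop
  | Sum.inl a, Sum.inl b => a ≤ b
  | Sum.inl _, Sum.inr _ => True
  | Sum.inr _, Sum.inl _ => False
  | Sum.inr a, Sum.inr b => a ≤ b

/-- A super tableau of shape `D`: rows and columns weakly increase, the `x`-symbols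
strictly increase down columns, the `y`-symbols strictly increase along rows; entries
outside `D` are normalized to `Sum.inl 0`. -/
def IsSuperSSYT (D : Set Box) (T : Box → ℕ ⊕ ℕ) : Prop :=
  (∀ b ∈ D, (b.1, b.2 + 1) ∈ D → entryLE (T b) (T (b.1, b.2 + 1))) ∧
  (∀ b ∈ D, (b.1 + 1, b.2) ∈ D → entryLE (T b) (T (b.1 + 1, b.2))) ∧
  (∀ b ∈ D, (b.1 + 1, b.2) ∈ D →
    ∀ a c : ℕ, T b = Sum.inl a → T (b.1 + 1, b.2) = Sum.inl c → a < c) ∧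
  (∀ b ∈ D, (b.1, b.2 + 1) ∈ D →
    ∀ a c : ℕ, T b = Sum.inr a → T (b.1, b.2 + 1) = Sum.inr c → a < c) ∧
  (∀ b : Box, b ∉ D → T b = Sum.inl 0)

/-- The supersymmetric skew Schur function `s_D(X, Y)`, as a formal power series in the
variables `x_n, y_n`: the coefficient of a monomial `μ` is the number of super tableaux
of shape `D` using each symbol `v` exactly `μ v` times. -/
def superSchur (D : Set Box) : MvPowerSeries (ℕ ⊕ ℕ) ℤ :=
  fun μ =>
    ({T : Box → ℕ ⊕ ℕ | IsSuperSSYT D T ∧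
        ∀ v : ℕ ⊕ ℕ, μ v = {b ∈ D | T b = v}.ncard}.ncard : ℤ)

open Classical in
/-- The power series keeping the monomials of `f` in the variables `x_k` with `k < N`. -/
def truncVars (N : ℕ) (f : MvPowerSeries ℕ ℤ) : MvPowerSeries ℕ ℤ :=
  fun w => if ∀ k, N ≤ k → w k = 0 then f w else 0

open Classical in
theorem coeff_truncVars (N : ℕ) (f : MvPowerSeries ℕ ℤ) (w : ℕ →₀ ℕ) :
    MvPowerSeries.coeff w (truncVars N f) =
      if ∀ k, N ≤ k → w k = 0 then MvPowerSeries.coeff w f else 0 := rfl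

/-- The ring homomorphism setting all variables `x_k` with `N ≤ k` to zero. -/
def killVars (N : ℕ) : MvPowerSeries ℕ ℤ →+* MvPowerSeries ℕ ℤ where
  toFun := truncVars N
  map_zero' := by
    ext w
    simp [coeff_truncVars]
  map_one' := by
    classical
    ext w
    rw [coeff_truncVars, MvPowerSeries.coeff_one]
    by_cases h : w = 0 <;> simp [h]
  map_add' f g := by
    ext w
    simp only [coeff_truncVars, map_add]
    split_ifs <;> simp
  map_mul' f g := by
    classical
    ext w
    simp only [coeff_truncVars, MvPowerSeries.coeff_mul]
    split_ifs with h
    · refine Finset.sum_congr rfl fun p hp => ?_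
      rw [Finset.HasAntidiagonal.mem_antidiagonal] at hp
      have hw : ∀ k, N ≤ k → p.1 k = 0 ∧ p.2 k = 0 := by
        intro k hk
        have := h k hk
        rw [← hp, Finsupp.add_apply] at this
        omega
      rw [if_pos fun k hk => (hw k hk).1, if_pos fun k hk => (hw k hk).2]
    · refine (Finset.sum_eq_zero fun p hp => ?_).symm
      rw [Finset.HasAntidiagonal.mem_antidiagonal] at hp
      split_ifs with h1 h2
      · exact absurd (fun k hk => by rw [← hp, Finsupp.add_apply, h1 k hk, h2 k hk]) h
      all_goals simp

open Classical in
theorem coeff_killVars (N : ℕ) (f : MvPowerSeries ℕ ℤ) (w : ℕ →₀ ℕ) :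
    MvPowerSeries.coeff w (killVars N f) =
      if ∀ k, N ≤ k → w k = 0 then MvPowerSeries.coeff w f else 0 := rfl

open Classical in
theorem coeff_eSym (r : ℤ) (w : ℕ →₀ ℕ) :
    MvPowerSeries.coeff w (eSym r) = if (∀ k, w k ≤ 1) ∧ (w.degree : ℤ) = r then 1 else 0 := by
  change (if _ then (1 : ℤ) else 0) = _
  refine if_congr (and_congr (forall_congr' fun k => ?_) Iff.rfl) rfl rfl
  rw [Finsupp.mem_support_iff]
  omega

theorem killVars_zero_eSym (r : ℤ) : killVars 0 (eSym r) = if r = 0 then 1 else 0 := by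
  classical
  ext w
  rw [coeff_killVars, coeff_eSym]
  by_cases hw : w = 0
  · subst hw
    by_cases hr : r = 0 <;> simp [hr, eq_comm]
  · have : ¬ ∀ k, 0 ≤ k → w k = 0 := fun h => hw (Finsupp.ext fun k => h k k.zero_le)
    rw [if_neg this]
    split_ifs <;> simp [MvPowerSeries.coeff_one, hw]

theorem killVars_succ_eSym (N : ℕ) (r : ℤ) :
    killVars (N + 1) (eSym r) =
      killVars N (eSym r) + MvPowerSeries.X N * killVars N (eSym (r - 1)) := by
  classical
  ext w
  obtain ⟨u, t, hu, rfl⟩ : ∃ (u : ℕ →₀ ℕ) (t : ℕ), u N = 0 ∧ w = u + Finsupp.single N t :=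
    ⟨w.erase N, w N, Finsupp.erase_same, (Finsupp.erase_add_single N w).symm⟩
  have hle : Finsupp.single N 1 ≤ u + Finsupp.single N t ↔ 1 ≤ t := by
    rw [Finsupp.single_le_iff]
    simp [hu]
  have hsub : u + Finsupp.single N t - Finsupp.single N 1 = u + Finsupp.single N (t - 1) := by
    ext k
    by_cases hk : N = k
    · subst hk; simp [hu]
    · simp [hk]
  have hval (s k : ℕ) : (u + Finsupp.single N s : ℕ →₀ ℕ) k = if k = N then s else u k := by
    by_cases hk : k = N
    · subst hk; simp [hu]
    · simp [hk]
  have hsupp (s : ℕ) : (∀ k, N ≤ k → (u + Finsupp.single N s) k = 0) ↔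
      s = 0 ∧ ∀ k, N + 1 ≤ k → u k = 0 := by
    simp only [hval]
    grind
  have hsupp' : (∀ k, N + 1 ≤ k → (u + Finsupp.single N t) k = 0) ↔
      ∀ k, N + 1 ≤ k → u k = 0 := by
    simp only [hval]
    grind
  have hsq (s : ℕ) : (∀ k, (u + Finsupp.single N s) k ≤ 1) ↔ s ≤ 1 ∧ ∀ k, u k ≤ 1 := by
    simp only [hval]
    grind
  rw [map_add, MvPowerSeries.X, MvPowerSeries.coeff_monomial_mul, hsub]
  simp only [hle, coeff_killVars, coeff_eSym, hsupp, hsupp', hsq, map_add, Finsupp.degree_single]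
  by_cases hA : ∀ k, N + 1 ≤ k → u k = 0 <;> by_cases hB : ∀ k, u k ≤ 1 <;>
    simp only [hA, hB, and_true, and_false, false_and, if_false, ite_self, implies_true,
      mul_zero, one_mul, add_zero]
  push_cast
  rcases t with _ | _ | t
  · simp
  · simp [eq_sub_iff_add_eq]
  · simp

/-- Subtract one from the entries indexed by `S`. -/
def dropAt {n : ℕ} (a : Fin n → ℤ) (S : Finset (Fin n)) (j : Fin n) : ℤ :=
  if j ∈ S then a j - 1 else a j

theorem det_eq_sum_dropAt {R : Type*} [CommRing R] {n : ℕ} (f g : ℤ → R) (x : R)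
    (hfg : ∀ r, f r = g r + x * g (r - 1)) (a : Fin n → ℤ) (t : Fin n → Fin n → ℤ) :
    Matrix.det (Matrix.of fun i j => f (a i + t i j)) =
      ∑ S : Finset (Fin n), x ^ S.card *
        Matrix.det (Matrix.of fun i j => g (dropAt a S i + t i j)) := by
  classical
  have h1 : (Matrix.of fun i j => f (a i + t i j)) =
      ((fun i j => x * g (a i - 1 + t i j)) + fun i j => g (a i + t i j) : Fin n → Fin n → R) := by
    ext i j
    simp only [Matrix.of_apply, Pi.add_apply, hfg]
    rw [add_comm, show a i + t i j - 1 = a i - 1 + t i j by ring]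
  have h2 := (Matrix.detRowAlternating (n := Fin n) (R := R)).toMultilinearMap.map_add_univ
    (fun i j => x * g (a i - 1 + t i j)) (fun i j => g (a i + t i j))
  rw [h1]
  refine h2.trans (Finset.sum_congr rfl fun S _ => ?_)
  have h3 := (Matrix.detRowAlternating (n := Fin n) (R := R)).toMultilinearMap.map_piecewise_smul
    (fun _ => x) (fun i j => g (dropAt a S i + t i j)) S
  rw [Finset.prod_const, smul_eq_mul] at h3
  refine Eq.trans ?_ h3
  congr 1
  ext i j
  by_cases hi : i ∈ S <;> simp [hi, dropAt]

theorem antitone_fin_of_succ_le {n : ℕ} (f : Fin n → ℤ)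
    (h : ∀ i j : Fin n, (j : ℕ) = i + 1 → f j ≤ f i) : Antitone f := by
  cases n with
  | zero => exact fun i => i.elim0
  | succ n => exact Fin.antitone_iff_succ_le.2 fun i => h _ _ (by simp)

theorem det_eq_zero_of_not_antitone_dropAt {R : Type*} [CommRing R] {n : ℕ} (g : ℤ → R)
    (a b : Fin n → ℤ) (ha : Antitone a) (S : Finset (Fin n)) (hS : ¬ Antitone (dropAt a S)) :
    Matrix.det (Matrix.of fun i j : Fin n =>
      g (dropAt a S i + (- b j - ((i : ℕ) + 1 : ℤ) + ((j : ℕ) + 1 : ℤ)))) = 0 := by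
  obtain ⟨i, j, hij, hlt⟩ : ∃ i j : Fin n, (j : ℕ) = i + 1 ∧ dropAt a S i < dropAt a S j := by
    by_contra! h
    exact hS (antitone_fin_of_succ_le _ h)
  have hle : a j ≤ a i := ha (Fin.le_def.2 (by omega))
  have hne : i ≠ j := by rintro rfl; omega
  refine Matrix.det_zero_of_row_eq hne (funext fun k => ?_)
  simp only [Matrix.of_apply]
  congr 1
  have : dropAt a S j = dropAt a S i + 1 := by
    unfold dropAt at hlt ⊢
    split_ifs at hlt ⊢ <;> omega
  rw [this, hij]
  push_cast
  ring

theorem det_indicator_eq {R : Type*} [CommRing R] {n : ℕ} (a b : Fin n → ℤ)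
    (ha : Antitone a) (hb : Antitone b) :
    Matrix.det (Matrix.of fun i j : Fin n =>
      if a i + (- b j - ((i : ℕ) + 1 : ℤ) + ((j : ℕ) + 1 : ℤ)) = 0 then (1 : R) else 0) =
      if a = b then 1 else 0 := by
  have hanti (c : Fin n → ℤ) (hc : Antitone c) :
      StrictMono (fun i : Fin n => ((i : ℕ) : ℤ) - c i) := by
    intro i j hij
    have := hc hij.le
    have : (i : ℕ) < j := hij
    simp only
    omega
  split_ifs with hab
  · subst hab
    refine Eq.trans (congrArg Matrix.det ?_) Matrix.det_one
    ext i j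
    rw [Matrix.of_apply, Matrix.one_apply]
    refine if_congr ⟨fun h => (hanti a ha).injective ?_, ?_⟩ rfl rfl
    · omega
    · rintro rfl; ring
  · have hrange : ¬ Set.range (fun i : Fin n => ((i : ℕ) : ℤ) - a i) ⊆
        Set.range (fun i : Fin n => ((i : ℕ) : ℤ) - b i) := by
      intro hsub
      refine hab ?_
      have heq := Set.eq_of_subset_of_ncard_le hsub (by
        rw [Set.ncard_range_of_injective (hanti a ha).injective,
          Set.ncard_range_of_injective (hanti b hb).injective]) (Set.finite_range _)
      have := (hanti a ha).range_inj (hanti b hb) |>.1 heq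
      ext i
      have := congrFun this i
      omega
    obtain ⟨_, ⟨i, rfl⟩, hi⟩ := Set.not_subset.1 hrange
    refine Matrix.det_eq_zero_of_row_eq_zero i fun j => ?_
    rw [Matrix.of_apply, if_neg]
    intro h
    exact hi ⟨j, by simp only; omega⟩

/-- The boxes `(i, j + 1)` with `b j < i ≤ a j`: the diagram whose columns are the intervals
between `b` and `a`. -/
def colShape {n : ℕ} (a b : Fin n → ℤ) : Set Box :=
  {c | ∃ j : Fin n, c.2 = (j : ℕ) + 1 ∧ b j < c.1 ∧ c.1 ≤ a j}

theorem mem_colShape {n : ℕ} {a b : Fin n → ℤ} {i : ℤ} {j : Fin n} :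
    ((i, ((j : ℕ) : ℤ) + 1) : Box) ∈ colShape a b ↔ b j < i ∧ i ≤ a j := by
  refine ⟨?_, fun h => ⟨j, rfl, h⟩⟩
  rintro ⟨k, hk, h⟩
  obtain rfl : j = k := Fin.ext (by simp only at hk; omega)
  exact h

theorem finite_colShape {n : ℕ} (a b : Fin n → ℤ) : (colShape a b).Finite := by
  refine (Set.finite_iUnion fun j : Fin n =>
    (Set.finite_Icc (b j) (a j)).prod (Set.finite_singleton (((j : ℕ) : ℤ) + 1))).subset ?_
  rintro ⟨x, y⟩ ⟨j, hj, h1, h2⟩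
  exact Set.mem_iUnion.2 ⟨j, ⟨h1.le, h2⟩, hj⟩

/-- The bottom boxes `(a j, j + 1)` of the columns indexed by `S`. -/
def bottomCells {n : ℕ} (a : Fin n → ℤ) (S : Finset (Fin n)) : Set Box :=
  (fun j : Fin n => ((a j, ((j : ℕ) : ℤ) + 1) : Box)) '' S

theorem mem_bottomCells {n : ℕ} {a : Fin n → ℤ} {S : Finset (Fin n)} {i : ℤ} {j : Fin n} :
    ((i, ((j : ℕ) : ℤ) + 1) : Box) ∈ bottomCells a S ↔ j ∈ S ∧ i = a j := by
  constructor
  · rintro ⟨k, hk, h⟩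
    rw [Prod.mk.injEq] at h
    obtain rfl : k = j := Fin.ext (by omega)
    exact ⟨hk, h.1.symm⟩
  · rintro ⟨hj, rfl⟩
    exact ⟨j, hj, rfl⟩

theorem ncard_bottomCells {n : ℕ} (a : Fin n → ℤ) (S : Finset (Fin n)) :
    (bottomCells a S).ncard = S.card := by
  rw [bottomCells, Set.ncard_image_of_injective, Set.ncard_coe_finset]
  intro i j hij
  rw [Prod.mk.injEq] at hij
  exact Fin.ext (by omega)

theorem disjoint_colShape_bottomCells {n : ℕ} (a b : Fin n → ℤ) (S : Finset (Fin n)) :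
    Disjoint (colShape (dropAt a S) b) (bottomCells a S) := by
  rw [Set.disjoint_left]
  rintro ⟨i, _⟩ ⟨j, rfl, -, h⟩ hc
  obtain ⟨hj, rfl⟩ := mem_bottomCells.1 hc
  simp only [dropAt, hj, if_true] at h
  omega

theorem colShape_eq_union {n : ℕ} {a b : Fin n → ℤ} {S : Finset (Fin n)}
    (hb : b ≤ dropAt a S) :
    colShape a b = colShape (dropAt a S) b ∪ bottomCells a S := by
  ext ⟨i, y⟩
  by_cases hy : ∃ j : Fin n, y = (j : ℕ) + 1
  · obtain ⟨j, rfl⟩ := hy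
    have : b j ≤ dropAt a S j := hb j
    rw [Set.mem_union, mem_colShape, mem_colShape, mem_bottomCells]
    unfold dropAt at this ⊢
    by_cases hj : j ∈ S
    · simp only [hj, if_true, true_and] at this ⊢
      omega
    · simp [hj]
  · refine iff_of_false ?_ ?_
    · rintro ⟨j, h, -⟩
      exact hy ⟨j, h⟩
    · rintro (⟨j, h, -⟩ | ⟨j, -, h⟩)
      · exact hy ⟨j, h⟩
      · exact hy ⟨j, (Prod.mk.inj h).2.symm⟩

/-- The semistandard tableaux of shape `colShape a b` with entries less than `N` and weight `w`;
there are none unless the shape is a skew diagram. -/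
def tableaux {n : ℕ} (b : Fin n → ℤ) (N : ℕ) (a : Fin n → ℤ) (w : ℕ →₀ ℕ) : Set (Box → ℕ) :=
  {T | Antitone a ∧ b ≤ a ∧ IsSSYT (colShape a b) T ∧ (∀ c ∈ colShape a b, T c < N) ∧
    ∀ k, w k = {c ∈ colShape a b | T c = k}.ncard}

open Classical in
/-- Overwrite a filling by the constant `N` on the bottom boxes of the columns indexed by `S`. -/
def fillBottom {n : ℕ} (a : Fin n → ℤ) (S : Finset (Fin n)) (N : ℕ) (T : Box → ℕ) (c : Box) : ℕ :=
  if c ∈ bottomCells a S then N else T c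

theorem ncard_fillBottom {n : ℕ} {a b : Fin n → ℤ} {S : Finset (Fin n)} (hb : b ≤ dropAt a S)
    (N : ℕ) (T : Box → ℕ) (k : ℕ) :
    {c ∈ colShape a b | fillBottom a S N T c = k}.ncard =
      {c ∈ colShape (dropAt a S) b | T c = k}.ncard + Finsupp.single N S.card k := by
  have hdisj := disjoint_colShape_bottomCells a b S
  have hset : {c ∈ colShape a b | fillBottom a S N T c = k} =
      {c ∈ colShape (dropAt a S) b | T c = k} ∪ {c ∈ bottomCells a S | N = k} := by
    ext c
    have hc : c ∈ colShape (dropAt a S) b → c ∉ bottomCells a S := fun h =>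
      Set.disjoint_left.1 hdisj h
    rw [colShape_eq_union hb]
    simp only [fillBottom, Set.mem_ofPred_eq, Set.mem_union]
    by_cases hc' : c ∈ bottomCells a S
    · simp [hc', show c ∉ colShape (dropAt a S) b from fun h => hc h hc']
    · simp [hc']
  rw [hset, Set.ncard_union_eq (hdisj.mono (Set.sep_subset _ _) (Set.sep_subset _ _))
    ((finite_colShape _ _).sep _) ((S.finite_toSet.image _).sep _)]
  congr 1
  by_cases hk : N = k
  · simp [hk, ncard_bottomCells]
  · simp [hk]

theorem le_of_le_dropAt {n : ℕ} {a b : Fin n → ℤ} {S : Finset (Fin n)} (hb : b ≤ dropAt a S) :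
    b ≤ a := by
  intro j
  change b j ≤ a j
  have : b j ≤ dropAt a S j := hb j
  unfold dropAt at this
  split_ifs at this <;> omega

theorem fillBottom_mem_tableaux {n : ℕ} {a b : Fin n → ℤ} (ha : Antitone a)
    {S : Finset (Fin n)} {N : ℕ} {u : ℕ →₀ ℕ} {T : Box → ℕ} (hT : T ∈ tableaux b N (dropAt a S) u) :
    fillBottom a S N T ∈ tableaux b (N + 1) a (u + Finsupp.single N S.card) := by
  obtain ⟨hanti, hb, ⟨hrow, hcol, hzero⟩, hlt, hw⟩ := hT
  have hunion := colShape_eq_union hb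
  have hdisj := disjoint_colShape_bottomCells a b S
  have hle : ∀ c ∈ colShape a b, fillBottom a S N T c ≤ N := by
    intro c hc
    unfold fillBottom
    split_ifs with h
    · exact le_rfl
    · rw [hunion] at hc
      exact (hlt c (hc.resolve_right h)).le
  have hnew : ∀ c ∈ bottomCells a S, fillBottom a S N T c = N := fun c hc => if_pos hc
  have hold : ∀ c ∈ colShape (dropAt a S) b, fillBottom a S N T c = T c := fun c hc =>
    if_neg (Set.disjoint_left.1 hdisj hc)
  refine ⟨ha, le_of_le_dropAt hb, ⟨?_, ?_, ?_⟩, fun c hc => Nat.lt_succ_of_le (hle c hc), ?_⟩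
  · intro c hc hc'
    by_cases h' : (c.1, c.2 + 1) ∈ bottomCells a S
    · rw [hnew _ h']
      exact hle c hc
    · have h2 : (c.1, c.2 + 1) ∈ colShape (dropAt a S) b := by
        rw [hunion] at hc'
        exact hc'.resolve_right h'
      have h1 : c ∈ colShape (dropAt a S) b := by
        obtain ⟨i, y⟩ := c
        obtain ⟨j, rfl, hj1, hj2⟩ := hc
        obtain ⟨k, hk, hk1, hk2⟩ := h2
        exact mem_colShape.2 ⟨hj1, hk2.trans (hanti (Fin.le_def.2 (by simp only at hk; omega)))⟩
      rw [hold _ h1, hold _ h2]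
      exact hrow c h1 h2
  · intro c hc hc'
    have h1 : c ∈ colShape (dropAt a S) b := by
      obtain ⟨i, y⟩ := c
      obtain ⟨j, rfl, hj1, hj2⟩ := hc
      have hc2 := (mem_colShape.1 hc').2
      refine mem_colShape.2 ⟨hj1, ?_⟩
      unfold dropAt
      simp only at *
      split_ifs <;> omega
    rw [hold _ h1]
    by_cases h' : (c.1 + 1, c.2) ∈ bottomCells a S
    · rw [hnew _ h']
      exact hlt c h1
    · have h2 : (c.1 + 1, c.2) ∈ colShape (dropAt a S) b := by
        rw [hunion] at hc'
        exact hc'.resolve_right h'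
      rw [hold _ h2]
      exact hcol c h1 h2
  · intro c hc
    rw [hunion, Set.mem_union, not_or] at hc
    rw [fillBottom, if_neg hc.2]
    exact hzero c hc.1
  · intro k
    rw [ncard_fillBottom hb, ← hw, Finsupp.add_apply]

theorem add_le_of_column {n : ℕ} {a b : Fin n → ℤ} {T : Box → ℕ} (hT : IsSSYT (colShape a b) T)
    (j : Fin n) {i i' : ℤ} (hi : b j < i) (hii' : i ≤ i') (hi' : i' ≤ a j) :
    (T (i, ((j : ℕ) : ℤ) + 1) : ℤ) + (i' - i) ≤ T (i', ((j : ℕ) : ℤ) + 1) := by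
  induction i', hii' using Int.leInduction with
  | base => simp
  | succ m hm ih =>
    have h1 := ih (by omega)
    have h2 := hT.2.1 (m, ((j : ℕ) : ℤ) + 1) (mem_colShape.2 ⟨by omega, by omega⟩)
      (mem_colShape.2 ⟨by omega, hi'⟩)
    simp only at h2
    omega

open Classical in
theorem exists_fillBottom_eq {n : ℕ} {a b : Fin n → ℤ} (hanti_b : Antitone b) {N : ℕ} {w : ℕ →₀ ℕ}
    {T : Box → ℕ} (hT : T ∈ tableaux b (N + 1) a w) :
    ∃ S : Finset (Fin n), Finsupp.single N S.card ≤ w ∧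
      ∃ T' ∈ tableaux b N (dropAt a S) (w - Finsupp.single N S.card), fillBottom a S N T' = T := by
  obtain ⟨ha, hba, hssyt, hlt, hw⟩ := hT
  obtain ⟨S, hS⟩ : ∃ S : Finset (Fin n), ∀ j, j ∈ S ↔
      b j < a j ∧ T (a j, ((j : ℕ) : ℤ) + 1) = N :=
    ⟨Finset.univ.filter fun j => b j < a j ∧ T (a j, ((j : ℕ) : ℤ) + 1) = N, by simp⟩
  have hb : b ≤ dropAt a S := by
    intro j
    change b j ≤ dropAt a S j
    have : b j ≤ a j := hba j
    unfold dropAt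
    split_ifs with hj
    · have := ((hS j).1 hj).1
      omega
    · exact this
  have hunion := colShape_eq_union hb
  have hdisj := disjoint_colShape_bottomCells a b S
  set T' : Box → ℕ := fun c => if c ∈ bottomCells a S then 0 else T c with hT'
  have hold : ∀ c ∈ colShape (dropAt a S) b, T' c = T c := fun c hc =>
    if_neg (Set.disjoint_left.1 hdisj hc)
  have hsub : colShape (dropAt a S) b ⊆ colShape a b := hunion ▸ Set.subset_union_left
  have hfill : fillBottom a S N T' = T := by
    ext c
    unfold fillBottom
    split_ifs with h
    · obtain ⟨j, hj, rfl⟩ := h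
      exact ((hS j).1 hj).2.symm
    · exact if_neg h
  have hwt : ∀ k, w k =
      {c ∈ colShape (dropAt a S) b | T' c = k}.ncard + Finsupp.single N S.card k := by
    intro k
    rw [← ncard_fillBottom hb, hfill]
    exact hw k
  refine ⟨S, fun k => ?_, T', ⟨?_, hb, ⟨?_, ?_, ?_⟩, ?_, ?_⟩, hfill⟩
  · rw [hwt k]
    exact Nat.le_add_left _ _
  · refine antitone_fin_of_succ_le _ fun i j hij => ?_
    have hle : a j ≤ a i := ha (Fin.le_def.2 (by omega))
    have hbb : b j ≤ b i := hanti_b (Fin.le_def.2 (by omega))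
    have hkey : i ∈ S → a i = a j → j ∈ S := by
      intro hi hij'
      obtain ⟨h1, h2⟩ := (hS i).1 hi
      have hmem : ((a i, ((i : ℕ) : ℤ) + 1) : Box) ∈ colShape a b := mem_colShape.2 ⟨h1, le_rfl⟩
      have hmem' : ((a j, ((j : ℕ) : ℤ) + 1) : Box) ∈ colShape a b :=
        mem_colShape.2 ⟨by omega, le_rfl⟩
      have hcast : ((i : ℕ) : ℤ) + 1 + 1 = ((j : ℕ) : ℤ) + 1 := by omega
      have h3 := hssyt.1 (a i, ((i : ℕ) : ℤ) + 1) hmem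
      simp only [hcast, hij'] at h3
      have h4 := h3 hmem'
      have h5 := hlt _ hmem'
      rw [← hij', h2, hij'] at h4
      exact (hS j).2 ⟨by omega, by omega⟩
    unfold dropAt
    split_ifs with hj hi hi
    · omega
    · omega
    · have : a i ≠ a j := fun h => hj (hkey hi h)
      omega
    · omega
  · intro c hc hc'
    rw [hold _ hc, hold _ hc']
    exact hssyt.1 c (hsub hc) (hsub hc')
  · intro c hc hc'
    rw [hold _ hc, hold _ hc']
    exact hssyt.2.1 c (hsub hc) (hsub hc')
  · intro c hc
    by_cases h : c ∈ bottomCells a S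
    · exact if_pos h
    · rw [hT']
      simp only [h, if_false]
      refine hssyt.2.2 c ?_
      rw [hunion]
      exact fun h' => h'.elim hc h
  · intro c hc
    rw [hold _ hc]
    obtain ⟨i, y⟩ := c
    obtain ⟨j, rfl, h1, h2⟩ := hc
    simp only at h1 h2
    have hle : dropAt a S j ≤ a j := by
      unfold dropAt
      split_ifs <;> omega
    have h3 := add_le_of_column hssyt j h1 (h2.trans hle) le_rfl
    have h4 := hlt (a j, ((j : ℕ) : ℤ) + 1) (mem_colShape.2 ⟨by omega, le_rfl⟩)
    by_cases hj : j ∈ S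
    · simp only [dropAt, hj, if_true] at h2
      omega
    · have : T (a j, ((j : ℕ) : ℤ) + 1) ≠ N := fun h => hj ((hS j).2 ⟨by omega, h⟩)
      omega
  · intro k
    rw [Finsupp.tsub_apply, hwt k, Nat.add_sub_cancel]

open Classical in
/-- The tableaux with entries less than `N + 1` whose boxes filled with `N` are exactly the bottom
boxes of the columns indexed by `S`. -/
def tableauxFiber {n : ℕ} (b : Fin n → ℤ) (N : ℕ) (a : Fin n → ℤ) (w : ℕ →₀ ℕ)
    (S : Finset (Fin n)) : Set (Box → ℕ) :=
  if Finsupp.single N S.card ≤ w then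
    fillBottom a S N '' tableaux b N (dropAt a S) (w - Finsupp.single N S.card) else ∅

theorem tableaux_succ {n : ℕ} {a b : Fin n → ℤ} (ha : Antitone a) (hb : Antitone b) (N : ℕ)
    (w : ℕ →₀ ℕ) : tableaux b (N + 1) a w = ⋃ S, tableauxFiber b N a w S := by
  ext T
  simp only [Set.mem_iUnion, tableauxFiber]
  constructor
  · intro hT
    obtain ⟨S, hS, T', hT', rfl⟩ := exists_fillBottom_eq hb hT
    exact ⟨S, by rw [if_pos hS]; exact ⟨T', hT', rfl⟩⟩
  · rintro ⟨S, hS⟩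
    split_ifs at hS with h
    · obtain ⟨T', hT', rfl⟩ := hS
      have := fillBottom_mem_tableaux ha hT'
      rwa [tsub_add_cancel_of_le h] at this
    · exact hS.elim

theorem mem_iff_of_mem_tableauxFiber {n : ℕ} {a b : Fin n → ℤ} {N : ℕ} {w : ℕ →₀ ℕ}
    {S : Finset (Fin n)} {T : Box → ℕ} (hT : T ∈ tableauxFiber b N a w S) (j : Fin n) :
    j ∈ S ↔ b j < a j ∧ T (a j, ((j : ℕ) : ℤ) + 1) = N := by
  unfold tableauxFiber at hT
  split_ifs at hT with h
  · obtain ⟨T', ⟨-, hb, -, hlt, -⟩, rfl⟩ := hT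
    have hbj : b j ≤ dropAt a S j := hb j
    unfold fillBottom
    rw [mem_bottomCells]
    by_cases hj : j ∈ S
    · simp only [dropAt, hj, if_true] at hbj
      simp only [hj, and_self, if_true, true_iff, and_true]
      omega
    · simp only [hj, false_and, if_false, false_iff, not_and]
      intro hlt'
      exact (hlt _ (mem_colShape.2 ⟨hlt', by simp [dropAt, hj]⟩)).ne
  · exact hT.elim

theorem injOn_fillBottom {n : ℕ} (a b : Fin n → ℤ) (N : ℕ) (S : Finset (Fin n)) (u : ℕ →₀ ℕ) :
    Set.InjOn (fillBottom a S N) (tableaux b N (dropAt a S) u) := by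
  intro T hT T' hT' h
  have hdisj := disjoint_colShape_bottomCells a b S
  ext c
  by_cases hc : c ∈ bottomCells a S
  · have hc' := Set.disjoint_right.1 hdisj hc
    rw [hT.2.2.1.2.2 c hc', hT'.2.2.1.2.2 c hc']
  · simpa [fillBottom, hc] using congrFun h c

open Classical in
theorem ncard_tableauxFiber {n : ℕ} (a b : Fin n → ℤ) (N : ℕ) (S : Finset (Fin n)) (w : ℕ →₀ ℕ) :
    (tableauxFiber b N a w S).ncard = if Finsupp.single N S.card ≤ w then
      (tableaux b N (dropAt a S) (w - Finsupp.single N S.card)).ncard else 0 := by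
  unfold tableauxFiber
  split_ifs
  · exact (injOn_fillBottom a b N S _).ncard_image
  · exact Set.ncard_empty _

theorem mem_tableaux_zero {n : ℕ} {a b : Fin n → ℤ} {w : ℕ →₀ ℕ} {T : Box → ℕ}
    (hb : Antitone b) : T ∈ tableaux b 0 a w ↔ a = b ∧ w = 0 ∧ T = 0 := by
  constructor
  · rintro ⟨-, hba, hssyt, hlt, hw⟩
    have hempty : colShape a b = ∅ := Set.eq_empty_of_forall_notMem fun c hc => by
      simpa using hlt c hc
    refine ⟨funext fun j => le_antisymm ?_ (hba j), Finsupp.ext fun k => ?_, funext fun c => ?_⟩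
    · by_contra! h
      have : ((a j, ((j : ℕ) : ℤ) + 1) : Box) ∈ colShape a b := mem_colShape.2 ⟨h, le_rfl⟩
      simp [hempty] at this
    · simp [hw k, hempty]
    · exact hssyt.2.2 c (by simp [hempty])
  · rintro ⟨rfl, rfl, rfl⟩
    have hempty : colShape a a = ∅ := Set.eq_empty_of_forall_notMem fun c hc => by
      obtain ⟨j, -, h⟩ := hc
      omega
    exact ⟨hb, le_rfl, ⟨by simp [hempty], by simp [hempty], by simp⟩, by simp [hempty],
      by simp [hempty]⟩

theorem finite_tableaux {n : ℕ} {b : Fin n → ℤ} (hb : Antitone b) (N : ℕ) (a : Fin n → ℤ)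
    (w : ℕ →₀ ℕ) : (tableaux b N a w).Finite := by
  induction N generalizing a w with
  | zero => exact (Set.finite_singleton 0).subset fun T hT => ((mem_tableaux_zero hb).1 hT).2.2
  | succ N ih =>
    by_cases ha : Antitone a
    · rw [tableaux_succ ha hb]
      refine Set.finite_iUnion fun S => ?_
      unfold tableauxFiber
      split_ifs
      · exact (ih _ _).image _
      · exact Set.finite_empty
    · exact Set.finite_empty.subset fun T hT => (ha hT.1).elim

open Classical in
theorem ncard_tableaux_succ {n : ℕ} {a b : Fin n → ℤ} (ha : Antitone a) (hb : Antitone b) (N : ℕ)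
    (w : ℕ →₀ ℕ) : (tableaux b (N + 1) a w).ncard = ∑ S : Finset (Fin n),
      if Finsupp.single N S.card ≤ w then
        (tableaux b N (dropAt a S) (w - Finsupp.single N S.card)).ncard else 0 := by
  have hfin := finite_tableaux hb (N + 1) a w
  rw [tableaux_succ ha hb] at hfin ⊢
  rw [Set.ncard_iUnion_of_finite (fun S => hfin.subset (Set.subset_iUnion _ S)),
    finsum_eq_sum_of_fintype]
  · exact Finset.sum_congr rfl fun S _ => ncard_tableauxFiber a b N S w
  · intro S S' hne
    refine Set.disjoint_left.2 fun T hT hT' => hne (Finset.ext fun j => ?_)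
    exact (mem_iff_of_mem_tableauxFiber hT j).trans (mem_iff_of_mem_tableauxFiber hT' j).symm

/-- The dual Jacobi–Trudi identity in finitely many variables, coefficientwise. -/
theorem coeff_det_killVars_eSym {n : ℕ} {a b : Fin n → ℤ} (ha : Antitone a) (hb : Antitone b)
    (N : ℕ) (w : ℕ →₀ ℕ) :
    MvPowerSeries.coeff w (Matrix.det (Matrix.of fun i j : Fin n =>
      killVars N (eSym (a i + (- b j - ((i : ℕ) + 1 : ℤ) + ((j : ℕ) + 1 : ℤ)))))) =
      ((tableaux b N a w).ncard : ℤ) := by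
  classical
  induction N generalizing a w with
  | zero =>
    simp only [killVars_zero_eSym]
    rw [det_indicator_eq a b ha hb]
    by_cases hab : a = b
    · by_cases hw : w = 0
      · have : tableaux b 0 a w = {0} := by
          ext T
          simp [mem_tableaux_zero hb, hab, hw]
        rw [this]
        simp [hab, hw]
      · have : tableaux b 0 a w = ∅ := by
          ext T
          simp [mem_tableaux_zero hb, hw]
        rw [this]
        simp [hab, hw, MvPowerSeries.coeff_one]
    · have : tableaux b 0 a w = ∅ := by
        ext T
        simp [mem_tableaux_zero hb, hab]
      simp [this, hab]
  | succ N ih =>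
    rw [det_eq_sum_dropAt (fun r => killVars (N + 1) (eSym r)) (fun r => killVars N (eSym r))
      (MvPowerSeries.X N) (killVars_succ_eSym N), ncard_tableaux_succ ha hb, map_sum,
      Nat.cast_sum]
    refine Finset.sum_congr rfl fun S _ => ?_
    rw [MvPowerSeries.X_pow_eq, MvPowerSeries.coeff_monomial_mul]
    by_cases hw : Finsupp.single N S.card ≤ w
    · rw [if_pos hw, if_pos hw, one_mul]
      by_cases hS : Antitone (dropAt a S)
      · exact ih hS _
      · have : tableaux b N (dropAt a S) (w - Finsupp.single N S.card) = ∅ :=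
          Set.eq_empty_of_forall_notMem fun T hT => hS hT.1
        rw [det_eq_zero_of_not_antitone_dropAt (fun r => killVars N (eSym r)) a b ha S hS, this]
        simp
    · rw [if_neg hw, if_neg hw, Nat.cast_zero]

theorem le_conjPart_iff (lam : Partition') {i j : ℕ} (hi : 1 ≤ i) (hj : 1 ≤ j) :
    i ≤ conjPart lam j ↔ j ≤ lam.part i := by
  obtain ⟨N, hN⟩ := lam.eventually_zero
  have hfin : {i : ℕ | 1 ≤ i ∧ j ≤ lam.part i}.Finite :=
    (Set.finite_Iio N).subset fun k hk => by
      by_contra h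
      have := hN k (by simpa using h)
      have := hk.2
      omega
  constructor
  · intro h
    by_contra hlt
    have hsub : {i : ℕ | 1 ≤ i ∧ j ≤ lam.part i} ⊆ Finset.Ico 1 i := by
      intro k hk
      rw [Finset.coe_Ico]
      refine ⟨hk.1, ?_⟩
      by_contra hik
      exact hlt (hk.2.trans (lam.antitone (by omega)))
    have := Set.ncard_le_ncard hsub (Finset.finite_toSet _)
    rw [Set.ncard_coe_finset, Nat.card_Ico] at this
    unfold conjPart at h
    omega
  · intro h
    have hsub : (Finset.Icc 1 i : Set ℕ) ⊆ {i : ℕ | 1 ≤ i ∧ j ≤ lam.part i} := by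
      intro k hk
      rw [Finset.coe_Icc] at hk
      exact ⟨hk.1, h.trans (lam.antitone hk.2)⟩
    have := Set.ncard_le_ncard hsub hfin
    rw [Set.ncard_coe_finset, Nat.card_Icc] at this
    unfold conjPart
    omega

theorem conjPart_le_conjPart {lam mu : Partition'} {j k : ℕ} (hj : 1 ≤ j) (hk : 1 ≤ k)
    (h : ∀ i, j ≤ mu.part i → k ≤ lam.part i) : conjPart mu j ≤ conjPart lam k := by
  rcases Nat.eq_zero_or_pos (conjPart mu j) with h0 | h0
  · omega
  · exact (le_conjPart_iff lam h0 hk).2 (h _ ((le_conjPart_iff mu h0 hj).1 le_rfl))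

theorem antitone_conjPart (n : ℕ) (lam : Partition') :
    Antitone fun j : Fin n => (conjPart lam ((j : ℕ) + 1) : ℤ) := by
  intro i j hij
  have : (i : ℕ) ≤ j := hij
  exact Int.ofNat_le.2 (conjPart_le_conjPart (by omega) (by omega) fun k hk => by omega)

theorem skewCells_eq_colShape {n : ℕ} {lam : Partition'} (mu : Partition')
    (hln : ∀ j : ℕ, n < j → conjPart lam j = 0) :
    skewCells lam mu = colShape (fun j : Fin n => (conjPart lam ((j : ℕ) + 1) : ℤ))
      (fun j : Fin n => (conjPart mu ((j : ℕ) + 1) : ℤ)) := by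
  ext ⟨x, y⟩
  constructor
  · rintro ⟨h1, h2, h3⟩
    simp only at h1 h2 h3
    lift x to ℕ using by omega
    lift y to ℕ using by omega
    rw [Int.toNat_natCast] at h2 h3
    obtain ⟨j, rfl⟩ : ∃ j, y = j + 1 := ⟨y - 1, by omega⟩
    have h4 := (le_conjPart_iff lam (i := x) (j := j + 1) (by omega) (by omega)).2 (by omega)
    have h5 := (le_conjPart_iff mu (i := x) (j := j + 1) (by omega) (by omega)).not.2 (by omega)
    have hj : j < n := by
      by_contra hj
      have := hln (j + 1) (by omega)
      omega
    exact ⟨⟨j, hj⟩, by simp, by simp only; omega, by simp only; omega⟩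
  · rintro ⟨j, hy, h1, h2⟩
    simp only at hy h1 h2
    subst hy
    lift x to ℕ using by omega
    have h4 := (le_conjPart_iff lam (i := x) (j := j + 1) (by omega) (by omega)).1 (by omega)
    have h5 := (le_conjPart_iff mu (i := x) (j := j + 1) (by omega) (by omega)).not.1 (by omega)
    refine ⟨?_, ?_, ?_⟩ <;> simp only [Int.toNat_natCast] <;> omega

/-- **dual Jacobi–Trudi identity.** For partitions `μ ⊆ λ` whose conjugates
`λ'`, `μ'` have at most `n` parts, `s_{λ/μ} = det( e_{λ'_i - μ'_j - i + j} )_{1 ≤ i, j ≤ n}`. -/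
theorem dual_jacobi_trudi
    (n : ℕ) (lam mu : Partition')
    (hsub : ∀ i : ℕ, mu.part i ≤ lam.part i)
    (hln : ∀ j : ℕ, n < j → conjPart lam j = 0)
    (hmn : ∀ j : ℕ, n < j → conjPart mu j = 0) :
    schur (skewCells lam mu) =
      Matrix.det (Matrix.of fun i j : Fin n =>
        eSym ((conjPart lam ((i : ℕ) + 1) : ℤ) - (conjPart mu ((j : ℕ) + 1) : ℤ)
          - ((i : ℕ) + 1 : ℤ) + ((j : ℕ) + 1 : ℤ))) := by
  set a : Fin n → ℤ := fun j => (conjPart lam ((j : ℕ) + 1) : ℤ) with ha_def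
  set b : Fin n → ℤ := fun j => (conjPart mu ((j : ℕ) + 1) : ℤ) with hb_def
  have ha : Antitone a := antitone_conjPart n lam
  have hb : Antitone b := antitone_conjPart n mu
  have hba : b ≤ a := fun j => Int.ofNat_le.2
    (conjPart_le_conjPart (by omega) (by omega) fun i hi => hi.trans (hsub i))
  ext w
  obtain ⟨N, hN⟩ : ∃ N, ∀ k, N ≤ k → w k = 0 :=
    ⟨w.support.sup id + 1, fun k hk => by
      by_contra hne
      have := Finset.le_sup (f := id) (Finsupp.mem_support_iff.2 hne)
      simp only [id] at this
      omega⟩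
  have hcoeff (f : MvPowerSeries ℕ ℤ) :
      MvPowerSeries.coeff w f = MvPowerSeries.coeff w (killVars N f) := by
    rw [coeff_killVars, if_pos hN]
  rw [hcoeff (Matrix.det _), RingHom.map_det]
  have hmat : (killVars N).mapMatrix (Matrix.of fun i j : Fin n =>
      eSym (a i - b j - ((i : ℕ) + 1 : ℤ) + ((j : ℕ) + 1 : ℤ))) =
      Matrix.of fun i j : Fin n =>
        killVars N (eSym (a i + (- b j - ((i : ℕ) + 1 : ℤ) + ((j : ℕ) + 1 : ℤ)))) := by
    ext1 i j
    rw [RingHom.mapMatrix_apply, Matrix.map_apply, Matrix.of_apply, Matrix.of_apply]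
    congr 2
    ring
  refine Eq.trans ?_ ((congrArg (fun M => MvPowerSeries.coeff w (Matrix.det M)) hmat).trans
    (coeff_det_killVars_eSym ha hb N w)).symm
  change (({T : Box → ℕ | IsSSYT (skewCells lam mu) T ∧
    ∀ k : ℕ, w k = {c ∈ skewCells lam mu | T c = k}.ncard}.ncard : ℕ) : ℤ) = _
  rw [skewCells_eq_colShape mu hln]
  congr 2
  ext T
  refine ⟨fun hT => ⟨ha, hba, hT.1, fun c hc => ?_, hT.2⟩, fun hT => ⟨hT.2.2.1, hT.2.2.2.2⟩⟩
  by_contra! hle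
  have h0 := hT.2 (T c)
  rw [hN _ hle, eq_comm, Set.ncard_eq_zero ((finite_colShape a b).sep _)] at h0
  exact Set.notMem_empty c (h0 ▸ ⟨hc, rfl⟩)
end
end

section
/- Let λ/μ be an edgewise connected skew diagram and Π = (θ_1, …, θ_m) an outside decomposition indexed so that q(θ_1) > ⋯ > q(θ_m), with p_1 > ⋯ > p_m the decreasing rearrangement of p(θ_1), …, p(θ_m). Then the supersymmetric skew Schur function satisfies s_{λ/μ}(X,Y) = (−1)^{inv(Π)} · det(M), where M is the m×m matrix whose (i,j) entry is s_{φ[p_j, q(θ_i)]}(X,Y) when p_j ≤ q(θ_i) + 1 (with s_∅(X,Y) = 1 for the empty segment) and 0 when p_j > q(θ_i) + 1. -/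
noncomputable section

open scoped Classical in
/-- Cauchy–Binet expansion of an alternating map. -/
theorem AlternatingMap.map_sum_smul_eq_sum_strictMono {R V W K Ω : Type*} [CommRing R]
    [AddCommGroup V] [Module R V] [AddCommGroup W] [Module R W]
    [Fintype K] [LinearOrder K] [Fintype Ω] [LinearOrder Ω]
    (Φ : V [⋀^K]→ₗ[R] W) (v : Ω → V) (U : Ω → K → R) :
    Φ (fun k => ∑ ω, U ω k • v ω) =
      ∑ f : K → Ω with StrictMono f, (Matrix.of fun j k => U (f j) k).det • Φ (v ∘ f) := by
  have hleft : Φ (fun k => ∑ ω, U ω k • v ω) =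
      ∑ g : K → Ω with Function.Injective g, (∏ k, U (g k) k) • Φ (v ∘ g) := by
    rw [← AlternatingMap.coe_multilinearMap, MultilinearMap.map_sum]
    simp only [MultilinearMap.map_smul_univ, AlternatingMap.coe_multilinearMap]
    rw [Finset.sum_filter_of_ne]
    · rfl
    · intro g _ hg
      by_contra hinj
      refine hg ?_
      rw [Φ.map_eq_zero_of_not_injective _ (fun h => hinj h.of_comp), smul_zero]
  have hright : ∀ f : K → Ω, (Matrix.of fun j k => U (f j) k).det • Φ (v ∘ f) =
      ∑ σ : Equiv.Perm K, (∏ k, U (f (σ k)) k) • Φ (v ∘ f ∘ σ) := by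
    intro f
    rw [Matrix.det_apply, Finset.sum_smul]
    refine Finset.sum_congr rfl fun σ _ => ?_
    have h := Φ.map_perm (v ∘ f) σ
    rw [Function.comp_assoc] at h
    rw [h, smul_assoc, smul_comm]
    rfl
  rw [hleft, Finset.sum_congr rfl fun f _ => hright f, Finset.sum_sigma']
  symm
  refine Finset.sum_bij (fun (x : (_ : K → Ω) × Equiv.Perm K) _ => x.1 ∘ x.2) ?_ ?_ ?_ ?_
  · rintro ⟨f, σ⟩ h
    simp only [Finset.mem_sigma, Finset.mem_filter, Finset.mem_univ, true_and, and_true] at h ⊢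
    exact h.injective.comp σ.injective
  · rintro ⟨f, σ⟩ h ⟨f', σ'⟩ h' heq
    simp only [Finset.mem_sigma, Finset.mem_filter, Finset.mem_univ, true_and, and_true] at h h' heq
    have hr : Set.range f = Set.range f' := by
      rw [← σ.surjective.range_comp f, ← σ'.surjective.range_comp f', heq]
    have hf : f = f' := (h.range_inj h').1 hr
    subst hf
    have : σ = σ' := Equiv.ext fun k => h.injective (congrFun heq k)
    rw [this]
  · intro g hg
    simp only [Finset.mem_filter, Finset.mem_univ, true_and] at hg
    let e : Fin (Fintype.card K) ≃o K := Fintype.orderIsoFinOfCardEq K rfl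
    let s : Equiv.Perm (Fin (Fintype.card K)) := Tuple.sort (g ∘ e)
    let σ : Equiv.Perm K := (e.symm.toEquiv.trans s).trans e.toEquiv
    have hmono : StrictMono (g ∘ σ) := by
      have h1 : StrictMono ((g ∘ e) ∘ s) :=
        (Tuple.monotone_sort (g ∘ e)).strictMono_of_injective
          ((hg.comp e.injective).comp s.injective)
      exact h1.comp e.symm.strictMono
    refine ⟨⟨g ∘ σ, σ.symm⟩, ?_, ?_⟩
    · simpa using hmono
    · ext k
      simp
  · intros
    rfl

/-- A zero-one matrix whose rows are weakly increasing initial segments has determinant `1` if it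
is lower unitriangular with all entries below the diagonal equal to one, and `0` otherwise. -/
theorem Matrix.det_staircase {R K : Type*} [CommRing R] [Fintype K] [LinearOrder K]
    (E : K → K → Prop) [∀ j k, Decidable (E j k)] [Decidable (∀ j k, E j k ↔ k ≤ j)]
    (hrow : ∀ j j' k, j ≤ j' → E j k → E j' k) (hcol : ∀ j k k', k ≤ k' → E j k' → E j k) :
    (Matrix.of fun j k => if E j k then (1 : R) else 0).det =
      if ∀ j k, E j k ↔ k ≤ j then 1 else 0 := by
  classical
  split_ifs with h
  · rw [Matrix.det_of_isLowerTriangular]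
    · simp [h]
    · intro j k hjk
      have hjk' : j < k := hjk
      simp [h, hjk']
  · by_contra hdet
    refine h ?_
    let S : K → Finset K := fun j => {k | E j k}
    have hS : ∀ j k, k ∈ S j ↔ E j k := by simp [S]
    have hmono : Monotone S := fun j j' hj k hk => (hS _ _).2 (hrow j j' k hj ((hS _ _).1 hk))
    have hinj : Function.Injective S := by
      intro j j' hj
      by_contra hne
      refine hdet (Matrix.det_zero_of_row_eq hne ?_)
      funext k
      have : E j k ↔ E j' k := by rw [← hS, ← hS, hj]
      simp [this]
    have hne : ∀ j, (S j).Nonempty := by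
      intro j
      rw [Finset.nonempty_iff_ne_empty]
      intro he
      refine hdet (Matrix.det_eq_zero_of_row_eq_zero j fun k => ?_)
      have : ¬ E j k := by rw [← hS, he]; simp
      simp [this]
    have hstrict : StrictMono S := hmono.strictMono_of_injective hinj
    let M : K → K := fun j => (S j).max' (hne j)
    have hM : ∀ j k, E j k ↔ k ≤ M j := by
      intro j k
      refine ⟨fun hk => Finset.le_max' _ _ ((hS _ _).2 hk), fun hk => hcol j k _ hk ?_⟩
      exact (hS _ _).1 ((S j).max'_mem (hne j))
    have hMmono : StrictMono M := by
      intro j j' hj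
      by_contra hle
      have hsub : S j' ⊆ S j := fun k hk => by
        rw [hS, hM] at hk ⊢
        exact hk.trans (not_lt.1 hle)
      exact (hstrict hj).not_ge hsub
    have hMid : ∀ j, M j = j := by
      have : M = id := by
        have hs : Function.Surjective M := Finite.surjective_of_injective hMmono.injective
        refine (hMmono.range_inj strictMono_id).1 ?_
        rw [hs.range_eq]
        simp
      intro j
      rw [this]
      rfl
    intro j k
    rw [hM, hMid]

/-- The extension of a relation by a largest element `none` on the left and a smallest element
`none` on the right. -/
def extRel {A : Type*} (rel : A → A → Prop) : Option A → Option A → Prop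
  | some a, some b => rel a b
  | _, _ => True

open scoped Classical in
/-- A single transition between consecutive diagonals: the value of an alternating map on the
transported vectors is a sum over the interlacing families. -/
theorem AlternatingMap.transition {R V W A K : Type*} [CommRing R]
    [AddCommGroup V] [Module R V] [AddCommGroup W] [Module R W]
    [Fintype K] [LinearOrder K] [Fintype A] [LinearOrder A]
    (Φ : V [⋀^K]→ₗ[R] W) (rel : A → A → Prop)
    (hleft : ∀ a a' b, a ≤ a' → rel a b → rel a' b)
    (hright : ∀ a b b', b ≤ b' → rel a b' → rel a b)
    (v : A → V) (u : V) (t : K → Option A)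
    (ht : ∀ k k', k < k' → ∃ b', t k' = some b' ∧ ∀ b, t k = some b → b ≤ b') :
    Φ (fun k => ∑ a, (if extRel rel (some a) (t k) then (1 : R) else 0) • v a + u) =
      ∑ f : K → Option A, if ∀ j k, extRel rel (f j) (t k) ↔ k ≤ j then
        Φ (fun k => (f k).elim u v) else 0 := by
  have hL : ∀ (x y : WithTop A) (o : Option A), x ≤ y → extRel rel x o → extRel rel y o := by
    intro x y o hxy h
    rcases o with _ | b
    · rcases y with _ | y <;> trivial
    · rcases y with _ | y
      · trivial
      · rcases x with _ | x
        · exact absurd hxy (WithTop.not_top_le_coe y)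
        · exact hleft x y b (WithTop.coe_le_coe.1 hxy) h
  have hR : ∀ (x : Option A) (k k' : K), k ≤ k' → extRel rel x (t k') → extRel rel x (t k) := by
    intro x k k' hk h
    rcases hk.eq_or_lt with rfl | hk
    · exact h
    · obtain ⟨b', hb', hb⟩ := ht k k' hk
      rcases x with _ | a
      · trivial
      · cases hb0 : t k with
        | none => trivial
        | some b =>
          rw [hb'] at h
          exact hright a b b' (hb b hb0) h
  let v' : WithTop A → V := fun x => Option.elim x u v
  have hcols : (fun k => ∑ a, (if extRel rel (some a) (t k) then (1 : R) else 0) • v a + u) =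
      fun k => ∑ x : WithTop A, (if extRel rel x (t k) then (1 : R) else 0) • v' x := by
    funext k
    have h := Fintype.sum_option
      (fun x : Option A => (if extRel rel x (t k) then (1 : R) else 0) • v' x)
    have h0 : extRel rel none (t k) := trivial
    rw [if_pos h0, one_smul, add_comm] at h
    exact h.symm
  rw [hcols, Φ.map_sum_smul_eq_sum_strictMono]
  have hmono : ∀ f : K → WithTop A, (∀ j k, extRel rel (f j) (t k) ↔ k ≤ j) → StrictMono f := by
    intro f hf j j' hj
    by_contra hle
    exact ((hf j j').not.2 hj.not_ge)
      (hL _ _ _ (not_lt.1 hle) ((hf j' j').2 le_rfl))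
  rw [Finset.sum_filter]
  refine Finset.sum_congr rfl fun f _ => ?_
  by_cases hf : StrictMono f
  · rw [if_pos hf, Matrix.det_staircase (fun j k => extRel rel (f j) (t k))
      (fun j j' k hj => hL _ _ _ (hf.monotone hj)) (fun j k k' hk => hR _ k k' hk)]
    split_ifs
    · rw [one_smul]
      rfl
    · rw [zero_smul]
  · rw [if_neg hf, if_neg (fun h => hf (hmono f h))]

open scoped Classical in
theorem AlternatingMap.transition_of_injective {R V W A K : Type*} [CommRing R]
    [AddCommGroup V] [Module R V] [AddCommGroup W] [Module R W]
    [Fintype K] [DecidableEq K] [Fintype A] [LinearOrder A]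
    (Φ : V [⋀^K]→ₗ[R] W) (rel : A → A → Prop) {e : K → ℤ} (he : Function.Injective e)
    (hleft : ∀ a a' b, a ≤ a' → rel a b → rel a' b)
    (hright : ∀ a b b', b ≤ b' → rel a b' → rel a b)
    (v : A → V) (u : V) (t : K → Option A)
    (ht : ∀ k k', e k < e k' → ∃ b', t k' = some b' ∧ ∀ b, t k = some b → b ≤ b') :
    Φ (fun k => ∑ a, (if extRel rel (some a) (t k) then (1 : R) else 0) • v a + u) =
      ∑ f : K → Option A, if ∀ j k, extRel rel (f j) (t k) ↔ e k ≤ e j then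
        Φ (fun k => (f k).elim u v) else 0 := by
  let order : LinearOrder K := LinearOrder.lift' e he
  convert AlternatingMap.transition Φ rel hleft hright v u t ht
  exact Iff.rfl

open scoped Classical in
/-- The version of `AlternatingMap.transition_of_injective` for the reversed order. -/
theorem AlternatingMap.transition_of_injective' {R V W A K : Type*} [CommRing R]
    [AddCommGroup V] [Module R V] [AddCommGroup W] [Module R W]
    [Fintype K] [DecidableEq K] [Fintype A] [LinearOrder A]
    (Φ : V [⋀^K]→ₗ[R] W) (rel : A → A → Prop) {e : K → ℤ} (he : Function.Injective e)
    (hleft : ∀ a a' b, a' ≤ a → rel a b → rel a' b)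
    (hright : ∀ a b b', b' ≤ b → rel a b' → rel a b)
    (v : A → V) (u : V) (t : K → Option A)
    (ht : ∀ k k', e k < e k' → ∃ b', t k' = some b' ∧ ∀ b, t k = some b → b' ≤ b) :
    Φ (fun k => ∑ a, (if extRel rel (some a) (t k) then (1 : R) else 0) • v a + u) =
      ∑ f : K → Option A, if ∀ j k, extRel rel (f j) (t k) ↔ e k ≤ e j then
        Φ (fun k => (f k).elim u v) else 0 :=
  AlternatingMap.transition_of_injective (A := Aᵒᵈ) Φ rel he hleft hright v u t ht

/-- The determinant of a matrix with some of its columns prescribed, as an alternating map in the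
remaining columns. -/
def detColumns {R ι : Type*} [CommRing R] [Fintype ι] [DecidableEq ι] (p : ι → Prop)
    [DecidablePred p] (C : ι → ι → R) : (ι → R) [⋀^{i // p i}]→ₗ[R] R where
  toFun x := Matrix.detRowAlternating fun i => if h : p i then x ⟨i, h⟩ else C i
  map_update_add' {inst} x i a b := by
    have key : ∀ z : ι → R,
        (fun k => if h : p k then (@Function.update _ _ inst x i z) ⟨k, h⟩ else C k) =
          Function.update (fun k => if h : p k then x ⟨k, h⟩ else C k) i z := by
      intro z
      funext k
      by_cases hk : k = i
      · subst hk
        simp [i.2]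
      · by_cases h : p k
        · have : (⟨k, h⟩ : {i // p i}) ≠ i := fun he => hk (by rw [← he])
          simp [h, hk, Function.update_of_ne this]
        · simp [h, hk]
    simp only [key]
    exact Matrix.detRowAlternating.map_update_add _ _ _ _
  map_update_smul' {inst} x i r a := by
    have key : ∀ z : ι → R,
        (fun k => if h : p k then (@Function.update _ _ inst x i z) ⟨k, h⟩ else C k) =
          Function.update (fun k => if h : p k then x ⟨k, h⟩ else C k) i z := by
      intro z
      funext k
      by_cases hk : k = i
      · subst hk
        simp [i.2]
      · by_cases h : p k
        · have : (⟨k, h⟩ : {i // p i}) ≠ i := fun he => hk (by rw [← he])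
          simp [h, hk, Function.update_of_ne this]
        · simp [h, hk]
    simp only [key]
    exact Matrix.detRowAlternating.map_update_smul _ _ _ _
  map_eq_zero_of_eq' x i j hx hij := by
    refine Matrix.detRowAlternating.map_eq_zero_of_eq _ (i := i.1) (j := j.1) ?_
      (fun h => hij (Subtype.ext h))
    simp [i.2, j.2, hx]

theorem detColumns_apply {R ι : Type*} [CommRing R] [Fintype ι] [DecidableEq ι] (p : ι → Prop)
    [DecidablePred p] (C : ι → ι → R) (x : {i // p i} → ι → R) :
    detColumns p C x = (Matrix.of fun i => if h : p i then x ⟨i, h⟩ else C i).det := rfl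

section Fillings

variable {A : Type*} [LinearOrder A]

/-- The relation between horizontally adjacent entries; `X` singles out the `x`-symbols. -/
def rowLE (X : A → Prop) (a b : A) : Prop := a < b ∨ (a = b ∧ X a)

/-- The relation between vertically adjacent entries; `X` singles out the `x`-symbols. -/
def colLE (X : A → Prop) (a b : A) : Prop := a < b ∨ (a = b ∧ ¬ X a)

theorem not_colLE {X : A → Prop} {a b : A} : ¬ colLE X b a ↔ rowLE X a b := by
  unfold colLE rowLE
  rcases lt_trichotomy a b with h | rfl | h
  · simp [h, h.not_gt, h.ne']
  · simp
  · simp [h, h.not_gt, h.ne']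

theorem rowLE.le {X : A → Prop} {a b : A} (h : rowLE X a b) : a ≤ b :=
  h.elim le_of_lt fun h => h.1.le

theorem colLE.le {X : A → Prop} {a b : A} (h : colLE X a b) : a ≤ b :=
  h.elim le_of_lt fun h => h.1.le

theorem rowLE.trans_le {X : A → Prop} {a b c : A} (h : rowLE X a b) (hc : b ≤ c) :
    rowLE X a c := by
  rcases hc.eq_or_lt with rfl | hc
  · exact h
  · exact Or.inl (h.le.trans_lt hc)

theorem rowLE.le_trans {X : A → Prop} {a b c : A} (hc : a ≤ b) (h : rowLE X b c) :
    rowLE X a c := by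
  rcases hc.eq_or_lt with rfl | hc
  · exact h
  · exact Or.inl (hc.trans_le h.le)

theorem colLE.trans_le {X : A → Prop} {a b c : A} (h : colLE X a b) (hc : b ≤ c) :
    colLE X a c := by
  rcases hc.eq_or_lt with rfl | hc
  · exact h
  · exact Or.inl (h.le.trans_lt hc)

theorem colLE.le_trans {X : A → Prop} {a b c : A} (hc : a ≤ b) (h : colLE X b c) :
    colLE X a c := by
  rcases hc.eq_or_lt with rfl | hc
  · exact h
  · exact Or.inl (hc.trans_le h.le)

theorem rowLE.trans_colLE {X : A → Prop} {a b c : A} (h : rowLE X a b) (h' : colLE X b c) :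
    a < c := by
  rcases h with h | ⟨rfl, h⟩
  · exact h.trans_le h'.le
  · exact h'.resolve_right fun h' => h'.2 h

variable [Inhabited A]

/-- A filling of the boxes of `B`, equal to `default` outside `B`. -/
def IsFilling (X : A → Prop) (B : Finset Box) (T : Box → A) : Prop :=
  (∀ b ∈ B, (b.1, b.2 + 1) ∈ B → rowLE X (T b) (T (b.1, b.2 + 1))) ∧
  (∀ b ∈ B, (b.1 + 1, b.2) ∈ B → colLE X (T b) (T (b.1 + 1, b.2))) ∧
  (∀ b ∉ B, T b = default)

theorem finite_isFilling [Finite A] (X : A → Prop) (B : Finset Box) :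
    {T : Box → A | IsFilling X B T}.Finite := by
  refine Set.Finite.of_finite_image (f := fun T (b : B) => T b) (Set.toFinite _) ?_
  intro T hT T' hT' h
  funext b
  by_cases hb : b ∈ B
  · exact congrFun h ⟨b, hb⟩
  · rw [hT.2.2 b hb, hT'.2.2 b hb]

/-- The finset of fillings of `B`. -/
def fillings [Finite A] (X : A → Prop) (B : Finset Box) : Finset (Box → A) :=
  (finite_isFilling X B).toFinset

theorem mem_fillings [Finite A] {X : A → Prop} {B : Finset Box} {T : Box → A} :
    T ∈ fillings X B ↔ IsFilling X B T := by
  simp [fillings]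

/-- The generating function of the fillings of `B` with respect to a weight on the symbols. -/
def fillSum [Finite A] {R : Type*} [CommRing R] (X : A → Prop) (w : A → R) (B : Finset Box) : R :=
  ∑ T ∈ fillings X B, ∏ b ∈ B, w (T b)

theorem fillings_empty [Finite A] (X : A → Prop) : fillings X ∅ = {fun _ => default} := by
  ext T
  rw [mem_fillings, Finset.mem_singleton]
  refine ⟨fun hT => funext fun b => hT.2.2 b (Finset.notMem_empty b), fun hT => ?_⟩
  subst hT
  exact ⟨by simp, by simp, fun _ _ => rfl⟩

/-- The boxes of `D` of content at least `c`. -/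
def upperPart (D : Finset Box) (c : ℤ) : Finset Box := {b ∈ D | c ≤ boxContent b}

theorem mem_upperPart {D : Finset Box} {c : ℤ} {b : Box} :
    b ∈ upperPart D c ↔ b ∈ D ∧ c ≤ b.2 - b.1 :=
  Finset.mem_filter

/-- Fillings strictly increase along diagonals. -/
theorem IsFilling.diag_lt {X : A → Prop} {D : Finset Box} (hD : (D : Set Box).OrdConnected)
    {c : ℤ} {T : Box → A} (hT : IsFilling X (upperPart D c) T) (b : Box)
    (hb : b ∈ upperPart D c) (n : ℕ) (hn : (b.1 + (n + 1), b.2 + (n + 1)) ∈ D) :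
    T b < T (b.1 + (n + 1), b.2 + (n + 1)) := by
  rw [mem_upperPart] at hb
  have between : ∀ x : Box, b.1 ≤ x.1 → b.2 ≤ x.2 → x.1 ≤ b.1 + (n + 1) → x.2 ≤ b.2 + (n + 1) →
      x ∈ D := fun x h1 h2 h3 h4 => hD.out hb.1 hn ⟨⟨h1, h2⟩, ⟨h3, h4⟩⟩
  have step : ∀ x : Box, b.1 ≤ x.1 → b.2 ≤ x.2 → x.1 + 1 ≤ b.1 + (n + 1) →
      x.2 + 1 ≤ b.2 + (n + 1) → x.2 - x.1 = b.2 - b.1 → T x < T (x.1 + 1, x.2 + 1) := by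
    intro x h1 h2 h3 h4 h5
    have hx : x ∈ upperPart D c := mem_upperPart.2 ⟨between _ h1 h2 (by lia) (by lia), by lia⟩
    have hr : (x.1, x.2 + 1) ∈ upperPart D c :=
      mem_upperPart.2 ⟨between _ h1 (by dsimp; lia) (by dsimp; lia) h4, by dsimp; lia⟩
    have hd : (x.1 + 1, x.2 + 1) ∈ upperPart D c :=
      mem_upperPart.2 ⟨between _ (by dsimp; lia) (by dsimp; lia) h3 h4, by dsimp; lia⟩
    exact (hT.1 x hx hr).trans_colLE (hT.2.1 _ hr hd)
  have main : ∀ k : ℕ, k ≤ n → T b < T (b.1 + (k + 1), b.2 + (k + 1)) := by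
    intro k
    induction k with
    | zero =>
      intro _
      simpa using step b le_rfl le_rfl (by lia) (by lia) rfl
    | succ k ih =>
      intro hk
      have h := step (b.1 + (k + 1), b.2 + (k + 1)) (by dsimp; lia) (by dsimp; lia)
        (by dsimp; lia) (by dsimp; lia) (by dsimp; lia)
      push_cast
      simp only [← add_assoc] at h ⊢
      refine lt_trans ?_ h
      simpa only [← add_assoc] using ih (by lia)
  exact main n le_rfl

end Fillings

section Kernel

variable {A R : Type*} [LinearOrder A] [Fintype A] [CommRing R]

/-- The relation between consecutive entries of the strip whose box of content `c` lies in
row `S c`. -/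
def stripRel (X : A → Prop) (S : ℤ → ℤ) (c : ℤ) (a b : A) : Prop :=
  if S (c + 1) = S c then rowLE X a b else colLE X b a

open scoped Classical in
/-- The generating function of the fillings of the strip segment of contents `p, …, p + n`
with last entry `a`, the weight of the last entry being omitted. -/
def transferVec (X : A → Prop) (w : A → R) (S : ℤ → ℤ) (p : ℤ) : ℕ → A → R
  | 0, _ => 1
  | n + 1, b => ∑ a, (if stripRel X S (p + n) a b then 1 else 0) * (w a * transferVec X w S p n a)

/-- The vector `transferVec` indexed by the content of the last entry. -/
def aliveVec (X : A → Prop) (w : A → R) (S : ℤ → ℤ) (p c : ℤ) (a : A) : R :=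
  if c < p then 0 else transferVec X w S p (c - p).toNat a

/-- The generating function of the fillings of the strip segment of contents `p, …, q`. -/
def segSum (X : A → Prop) (w : A → R) (S : ℤ → ℤ) (p q : ℤ) : R :=
  ∑ a, w a * aliveVec X w S p q a + if p = q + 1 then 1 else 0

theorem aliveVec_of_lt {X : A → Prop} {w : A → R} {S : ℤ → ℤ} {p c : ℤ} (h : c < p) (a : A) :
    aliveVec X w S p c a = 0 := if_pos h

theorem segSum_of_lt {X : A → Prop} {w : A → R} {S : ℤ → ℤ} {p q : ℤ} (h : q + 1 < p) :
    segSum X w S p q = 0 := by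
  simp [segSum, aliveVec_of_lt (show q < p by lia), h.ne']

theorem segSum_of_eq {X : A → Prop} {w : A → R} {S : ℤ → ℤ} {p q : ℤ} (h : p = q + 1) :
    segSum X w S p q = 1 := by
  subst h
  simp [segSum, aliveVec_of_lt (lt_add_one q)]

open scoped Classical in
theorem aliveVec_succ (X : A → Prop) (w : A → R) (S : ℤ → ℤ) (p c : ℤ) (b : A) :
    aliveVec X w S p (c + 1) b =
      ∑ a, (if stripRel X S c a b then 1 else 0) * (w a * aliveVec X w S p c a) +
        if p = c + 1 then 1 else 0 := by
  rcases lt_trichotomy p (c + 1) with h | h | h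
  · obtain ⟨n, rfl⟩ : ∃ n : ℕ, c = p + n := ⟨(c - p).toNat, by lia⟩
    have h1 : (p + n + 1 - p).toNat = n + 1 := by lia
    have h2 : (p + n - p).toNat = n := by lia
    simp only [aliveVec, if_neg (show ¬ p + n + 1 < p by lia), if_neg (show ¬ p + n < p by lia),
      h1, h2, if_neg h.ne, add_zero]
    rfl
  · subst h
    simp [aliveVec, transferVec]
  · simp [aliveVec_of_lt (show c < p by lia), aliveVec_of_lt h, h.ne']

end Kernel

section Strips

/-- The box of content `c` in the translate by `r` along the diagonal of the strip whose box of
content `c` lies in row `S c`. -/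
def stripBox (S : ℤ → ℤ) (r c : ℤ) : Box := (r + S c, r + S c + c)

/-- A decomposition of `D` into strips which are segments of the diagonal translates of one
strip. -/
structure IsStripDecomposition (S : ℤ → ℤ) (D : Finset Box) {m : ℕ} (r p q : Fin m → ℤ) :
    Prop where
  step : ∀ c, S (c + 1) = S c ∨ S (c + 1) = S c - 1
  convex : (D : Set Box).OrdConnected
  le : ∀ k, p k ≤ q k
  mem : ∀ k c, p k ≤ c → c ≤ q k → stripBox S (r k) c ∈ D
  cover : ∀ b ∈ D, ∃ k, p k ≤ b.2 - b.1 ∧ b.2 - b.1 ≤ q k ∧ b = stripBox S (r k) (b.2 - b.1)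
  unique : ∀ k k' c, p k ≤ c → c ≤ q k → p k' ≤ c → c ≤ q k' → r k = r k' → k = k'
  initial : ∀ k, stripBox S (r k) (p k - 1) ∉ D
  terminal : ∀ k, stripBox S (r k) (q k + 1) ∉ D

namespace IsStripDecomposition

variable {S : ℤ → ℤ} {D : Finset Box} {m : ℕ} {r p q : Fin m → ℤ}

theorem between (h : IsStripDecomposition S D r p q) {x y z : Box} (hx : x ∈ D) (hz : z ∈ D)
    (h1 : x.1 ≤ y.1) (h2 : x.2 ≤ y.2) (h3 : y.1 ≤ z.1) (h4 : y.2 ≤ z.2) : y ∈ D :=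
  h.convex.out hx hz ⟨⟨h1, h2⟩, ⟨h3, h4⟩⟩

theorem alive_or (h : IsStripDecomposition S D r p q) {c : ℤ} (k : Fin m) (h1 : p k ≤ c + 1)
    (h2 : c ≤ q k) : stripBox S (r k) c ∈ D ∨ stripBox S (r k) (c + 1) ∈ D := by
  rcases h1.lt_or_eq with h3 | h3
  · exact Or.inl (h.mem k c (by lia) h2)
  · exact Or.inr (h.mem k _ h1 (by have := h.le k; lia))

theorem eq_of_active (h : IsStripDecomposition S D r p q) {c : ℤ} {k k' : Fin m}
    (h1 : p k ≤ c + 1) (h2 : c ≤ q k) (h1' : p k' ≤ c + 1) (h2' : c ≤ q k') (hr : r k = r k') :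
    k = k' := by
  have hk := h.le k
  have hk' := h.le k'
  by_cases ha : p k ≤ c
  · by_cases hb : p k' ≤ c
    · exact h.unique k k' c ha h2 hb h2' hr
    · by_cases hq : q k = c
      · exfalso
        have := h.terminal k
        rw [hq, hr] at this
        exact this (h.mem k' _ h1' (by lia))
      · exact h.unique k k' (c + 1) h1 (by lia) h1' (by lia) hr
  · by_cases hq : q k' = c
    · exfalso
      have := h.terminal k'
      rw [hq, ← hr] at this
      exact this (h.mem k _ h1 (by lia))
    · exact h.unique k k' (c + 1) h1 (by lia) h1' (by lia) hr

/-- The position of a strip in a transition from content `c` to content `c + 1`. -/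
def pos (S : ℤ → ℤ) (c r : ℤ) : ℤ := if S (c + 1) = S c then -r else r

theorem pos_inj {c x y : ℤ} : pos S c x = pos S c y ↔ x = y := by
  unfold pos
  split_ifs <;> lia

theorem pos_le_of_start (h : IsStripDecomposition S D r p q) {c : ℤ} {j k : Fin m}
    (hj : p j = c + 1) (h1 : p k ≤ c + 1) (h2 : c ≤ q k) : pos S c (r k) ≤ pos S c (r j) := by
  have hn := h.initial j
  rw [hj, add_sub_cancel_right] at hn
  have hm : stripBox S (r j) (c + 1) ∈ D := h.mem j _ hj.le (by have := h.le j; lia)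
  have hk := h.alive_or k h1 h2
  unfold pos
  by_contra hlt
  rcases h.step c with hs | hs
  · rw [if_pos hs, if_pos hs] at hlt
    rcases hk with hk | hk <;>
    · refine hn (h.between hk hm ?_ ?_ ?_ ?_) <;> simp only [stripBox, hs] <;> lia
  · rw [if_neg (by lia), if_neg (by lia)] at hlt
    rcases hk with hk | hk <;>
    · refine hn (h.between hm hk ?_ ?_ ?_ ?_) <;> simp only [stripBox, hs] <;> lia

theorem pos_le_of_terminal (h : IsStripDecomposition S D r p q) {c : ℤ} {j k : Fin m}
    (hk : q k = c) (h1 : p j ≤ c + 1) (h2 : c ≤ q j) : pos S c (r k) ≤ pos S c (r j) := by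
  have hn := h.terminal k
  rw [hk] at hn
  have hm : stripBox S (r k) c ∈ D := h.mem k _ (by have := h.le k; lia) hk.ge
  have hj := h.alive_or j h1 h2
  unfold pos
  by_contra hlt
  rcases h.step c with hs | hs
  · rw [if_pos hs, if_pos hs] at hlt
    rcases hj with hj | hj <;>
    · refine hn (h.between hm hj ?_ ?_ ?_ ?_) <;> simp only [stripBox, hs] <;> lia
  · rw [if_neg (by lia), if_neg (by lia)] at hlt
    rcases hj with hj | hj <;>
    · refine hn (h.between hj hm ?_ ?_ ?_ ?_) <;> simp only [stripBox, hs] <;> lia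

end IsStripDecomposition

end Strips

namespace IsStripDecomposition

section Transition

variable {A R : Type*} [LinearOrder A] [CommRing R]
variable {S : ℤ → ℤ} {D : Finset Box} {m : ℕ} {r p q : Fin m → ℤ}

theorem lt_of_row_lt [Inhabited A] (h : IsStripDecomposition S D r p q) {X : A → Prop} {c : ℤ}
    {T : Box → A}
    (hT : IsFilling X (upperPart D c) T) {x y : ℤ} (hxy : x < y)
    (hx : stripBox S x c ∈ D) (hy : stripBox S y c ∈ D) :
    T (stripBox S x c) < T (stripBox S y c) := by
  obtain ⟨n, rfl⟩ : ∃ n : ℕ, y = x + (n + 1) := ⟨(y - x - 1).toNat, by lia⟩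
  have hb : stripBox S (x + (n + 1)) c =
      ((stripBox S x c).1 + ((n : ℤ) + 1), (stripBox S x c).2 + ((n : ℤ) + 1)) := by
    ext <;> simp only [stripBox] <;> ring
  rw [hb] at hy ⊢
  exact hT.diag_lt h.convex _ (mem_upperPart.2 ⟨hx, by simp [stripBox]⟩) n hy

variable [Fintype A]

/-- The column attached to strip `k` when the diagonals of content less than `c` have been
summed over. -/
def column (X : A → Prop) (w : A → R) (S : ℤ → ℤ) (r p q : Fin m → ℤ) (c : ℤ)
    (T : Box → A) (k : Fin m) : Fin m → R := fun j =>
  if c < p k then (if p j = p k then 1 else 0)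
  else if c ≤ q k then aliveVec X w S (p j) c (T (stripBox S (r k) c))
  else segSum X w S (p j) (q k)

/-- The strips taking part in the transition from content `c` to content `c + 1`. -/
abbrev Active (p q : Fin m → ℤ) (c : ℤ) (k : Fin m) : Prop := p k ≤ c + 1 ∧ c ≤ q k

/-- The entry of an active strip on the diagonal of content `c + 1`. -/
def nextEntry (S : ℤ → ℤ) (r q : Fin m → ℤ) (c : ℤ) (T : Box → A) (k : Fin m) : Option A :=
  if q k = c then none else some (T (stripBox S (r k) (c + 1)))

/-- The determinant in the columns of the active strips. -/
def activeDet (X : A → Prop) (w : A → R) (S : ℤ → ℤ) (p q : Fin m → ℤ) (c : ℤ) :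
    (Fin m → R) [⋀^{k // Active p q c k}]→ₗ[R] R :=
  detColumns (Active p q c) fun k j =>
    if c < p k then (if p j = p k then 1 else 0) else segSum X w S (p j) (q k)

/-- The weighted vectors transported by a transition. -/
def sourceVec (X : A → Prop) (w : A → R) (S : ℤ → ℤ) (p : Fin m → ℤ) (c : ℤ) (a : A) :
    Fin m → R := fun j => w a * aliveVec X w S (p j) c a

/-- The vector of the strips starting at content `c + 1`. -/
def birthVec (R : Type*) [CommRing R] (p : Fin m → ℤ) (c : ℤ) : Fin m → R :=
  fun j => if p j = c + 1 then 1 else 0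

open scoped Classical in
theorem det_column_succ (h : IsStripDecomposition S D r p q) (X : A → Prop) (w : A → R) (c : ℤ)
    (T : Box → A) :
    (Matrix.of (column X w S r p q (c + 1) T)).det =
      activeDet X w S p q c fun k =>
        ∑ a, (if extRel (stripRel X S c) (some a) (nextEntry S r q c T k.1) then (1 : R) else 0) •
          sourceVec X w S p c a + birthVec R p c := by
  rw [activeDet, detColumns_apply]
  congr 2
  funext k j
  by_cases hk : Active p q c k
  · rw [dif_pos hk]
    have h1 : ¬ c + 1 < p k := not_lt.2 hk.1
    simp only [column, if_neg h1, Pi.add_apply, Finset.sum_apply, Pi.smul_apply, smul_eq_mul,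
      sourceVec, birthVec]
    by_cases hq : q k = c
    · rw [if_neg (by lia), hq, segSum]
      simp [nextEntry, hq, extRel]
    · have := hk.2
      rw [if_pos (by lia), aliveVec_succ]
      simp [nextEntry, hq, extRel]
  · rw [dif_neg hk]
    simp only [column]
    by_cases h1 : c + 1 < p k
    · simp only [if_pos h1, if_pos (show c < p k by lia)]
    · have h2 : q k < c := not_le.1 fun h2 => hk ⟨not_lt.1 h1, h2⟩
      have := h.le k
      simp only [if_neg h1, if_neg (show ¬ c < p k by lia), if_neg (show ¬ c + 1 ≤ q k by lia)]

/-- The entries of the active strips on two consecutive diagonals interlace. -/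
def Interlaced (X : A → Prop) (S : ℤ → ℤ) (r p q : Fin m → ℤ) (c : ℤ) (T : Box → A)
    (f : {k // Active p q c k} → Option A) : Prop :=
  ∀ j k : {k // Active p q c k}, extRel (stripRel X S c) (f j) (nextEntry S r q c T k.1) ↔
    pos S c (r k.1) ≤ pos S c (r j.1)

open scoped Classical in
theorem det_column_transition [Inhabited A] (h : IsStripDecomposition S D r p q) (X : A → Prop)
    (w : A → R) (c : ℤ) (T : Box → A) (hT : IsFilling X (upperPart D (c + 1)) T) :
    (Matrix.of (column X w S r p q (c + 1) T)).det =
      ∑ f : {k // Active p q c k} → Option A, if Interlaced X S r p q c T f then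
        activeDet X w S p q c (fun k => (f k).elim (birthVec R p c) (sourceVec X w S p c))
        else 0 := by
  rw [det_column_succ h]
  have hinj : Function.Injective fun k : {k // Active p q c k} => pos S c (r k.1) := by
    intro j k hjk
    exact Subtype.ext (h.eq_of_active j.2.1 j.2.2 k.2.1 k.2.2 (pos_inj.1 hjk))
  have hne : ∀ j k : {k // Active p q c k}, pos S c (r j.1) < pos S c (r k.1) → q k.1 ≠ c := by
    intro j k hjk hq
    exact hjk.not_ge (h.pos_le_of_terminal hq j.2.1 j.2.2)
  have halive : ∀ k : {k // Active p q c k}, q k.1 ≠ c → stripBox S (r k.1) (c + 1) ∈ D :=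
    fun k hq => h.mem _ _ k.2.1 (by have := k.2.2; lia)
  have hsome : ∀ (k : {k // Active p q c k}) (b : A), nextEntry S r q c T k.1 = some b →
      q k.1 ≠ c ∧ T (stripBox S (r k.1) (c + 1)) = b := by
    intro k b hb
    unfold nextEntry at hb
    split_ifs at hb with hq
    exact ⟨hq, Option.some.inj hb⟩
  rcases h.step c with hs | hs
  · refine (AlternatingMap.transition_of_injective' (activeDet X w S p q c) (stripRel X S c) hinj
      ?_ ?_ (sourceVec X w S p c) (birthVec R p c) (fun k => nextEntry S r q c T k.1) ?_).trans
      (Finset.sum_congr rfl fun f _ => if_congr Iff.rfl rfl rfl)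
    · intro a a' b haa hab
      rw [stripRel, if_pos hs] at hab ⊢
      exact hab.le_trans haa
    · intro a b b' hbb hab
      rw [stripRel, if_pos hs] at hab ⊢
      exact hab.trans_le hbb
    · intro j k hjk
      have hq := hne j k hjk
      refine ⟨T (stripBox S (r k.1) (c + 1)), by simp [nextEntry, hq], ?_⟩
      intro b hb
      obtain ⟨hq', rfl⟩ := hsome j b hb
      rw [pos, pos, if_pos hs, if_pos hs] at hjk
      exact (h.lt_of_row_lt hT (by lia) (halive k hq) (halive j hq')).le
  · have hs' : S (c + 1) ≠ S c := by lia
    refine (AlternatingMap.transition_of_injective (activeDet X w S p q c) (stripRel X S c) hinj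
      ?_ ?_ (sourceVec X w S p c) (birthVec R p c) (fun k => nextEntry S r q c T k.1) ?_).trans
      (Finset.sum_congr rfl fun f _ => if_congr Iff.rfl rfl rfl)
    · intro a a' b haa hab
      rw [stripRel, if_neg hs'] at hab ⊢
      exact hab.trans_le haa
    · intro a b b' hbb hab
      rw [stripRel, if_neg hs'] at hab ⊢
      exact hab.le_trans hbb
    · intro j k hjk
      have hq := hne j k hjk
      refine ⟨T (stripBox S (r k.1) (c + 1)), by simp [nextEntry, hq], ?_⟩
      intro b hb
      obtain ⟨hq', rfl⟩ := hsome j b hb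
      rw [pos, pos, if_neg hs', if_neg hs'] at hjk
      exact (h.lt_of_row_lt hT hjk (halive j hq') (halive k hq)).le

end Transition

end IsStripDecomposition

namespace IsStripDecomposition

section Constancy

variable {A R : Type*} [LinearOrder A] [CommRing R] [Inhabited A]
variable {S : ℤ → ℤ} {D : Finset Box} {m : ℕ} {r p q : Fin m → ℤ}

theorem row_lt_of_mem (h : IsStripDecomposition S D r p q) {X : A → Prop} {c : ℤ} {T : Box → A}
    (hT : IsFilling X (upperPart D c) T) {x y : Box} (hx : x ∈ D) (hy : y ∈ D)
    (hc : c ≤ x.2 - x.1) (hxy : x.2 - x.1 = y.2 - y.1) (hlt : x.1 < y.1) : T x < T y := by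
  obtain ⟨n, hn⟩ : ∃ n : ℕ, y.1 = x.1 + (n + 1) := ⟨(y.1 - x.1 - 1).toNat, by lia⟩
  have hy' : y = (x.1 + ((n : ℤ) + 1), x.2 + ((n : ℤ) + 1)) := by
    ext <;> dsimp <;> lia
  rw [hy'] at hy ⊢
  exact hT.diag_lt h.convex _ (mem_upperPart.2 ⟨hx, hc⟩) n hy

theorem row_le_of_mem (h : IsStripDecomposition S D r p q) {X : A → Prop} {c : ℤ} {T : Box → A}
    (hT : IsFilling X (upperPart D c) T) {x y : Box} (hx : x ∈ D) (hy : y ∈ D)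
    (hc : c ≤ x.2 - x.1) (hxy : x.2 - x.1 = y.2 - y.1) (hle : x.1 ≤ y.1) : T x ≤ T y := by
  rcases hle.eq_or_lt with he | hlt
  · rw [show x = y by ext <;> lia]
  · exact (h.row_lt_of_mem hT hx hy hc hxy hlt).le

theorem rowLE_of_row_le (h : IsStripDecomposition S D r p q) {X : A → Prop} {c : ℤ} {T : Box → A}
    (hT : IsFilling X (upperPart D c) T) {x y : Box} (hx : x ∈ D) (hy : y ∈ D)
    (hxc : x.2 - x.1 = c) (hyc : y.2 - y.1 = c + 1) (hle : x.1 ≤ y.1) : rowLE X (T x) (T y) := by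
  have hz : (x.1, x.2 + 1) ∈ D := h.between hx hy le_rfl (by dsimp; lia) hle (by dsimp; lia)
  exact (hT.1 x (mem_upperPart.2 ⟨hx, hxc.ge⟩) (mem_upperPart.2 ⟨hz, by dsimp; lia⟩)).trans_le
    (h.row_le_of_mem hT hz hy (by dsimp; lia) (by dsimp; lia) hle)

theorem colLE_of_row_lt (h : IsStripDecomposition S D r p q) {X : A → Prop} {c : ℤ} {T : Box → A}
    (hT : IsFilling X (upperPart D c) T) {x y : Box} (hx : x ∈ D) (hy : y ∈ D)
    (hxc : x.2 - x.1 = c) (hyc : y.2 - y.1 = c + 1) (hlt : y.1 < x.1) : colLE X (T y) (T x) := by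
  have hz : (y.1 + 1, y.2) ∈ D := h.between hy hx (by dsimp; lia) le_rfl hlt (by dsimp; lia)
  exact (hT.2.1 y (mem_upperPart.2 ⟨hy, by lia⟩) (mem_upperPart.2 ⟨hz, by dsimp; lia⟩)).trans_le
    (h.row_le_of_mem hT hz hx (by dsimp; lia) (by dsimp; lia) hlt)

open scoped Classical in
/-- The part of a filling of content at least `c`. -/
def restrict (D : Finset Box) (c : ℤ) (T : Box → A) (b : Box) : A :=
  if b ∈ upperPart D c then T b else default

/-- The entries of a filling on the diagonal of content `c`, indexed by the active strips. -/
def diagEntry (S : ℤ → ℤ) (r p q : Fin m → ℤ) (c : ℤ) (T : Box → A)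
    (k : {k // Active p q c k}) : Option A :=
  if p k.1 = c + 1 then none else some (T (stripBox S (r k.1) c))

omit [LinearOrder A] in
theorem restrict_of_mem {c : ℤ} {T : Box → A} {b : Box} (hb : b ∈ D) (hc : c ≤ b.2 - b.1) :
    restrict D c T b = T b := if_pos (mem_upperPart.2 ⟨hb, hc⟩)

omit [LinearOrder A] in
theorem nextEntry_restrict (h : IsStripDecomposition S D r p q) {c : ℤ} {T : Box → A}
    (k : {k // Active p q c k}) (hq : q k.1 ≠ c) :
    nextEntry S r q c (restrict D (c + 1) T) k.1 = some (T (stripBox S (r k.1) (c + 1))) := by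
  rw [nextEntry, if_neg hq, restrict_of_mem (h.mem _ _ k.2.1 (by have := k.2.2; lia))]
  simp [stripBox]

/-- The description of the fillings of one more diagonal. -/
theorem isFilling_upperPart_iff (h : IsStripDecomposition S D r p q) {X : A → Prop} {c : ℤ}
    {T : Box → A} (hdef : ∀ b ∉ upperPart D c, T b = default) :
    IsFilling X (upperPart D c) T ↔
      IsFilling X (upperPart D (c + 1)) (restrict D (c + 1) T) ∧
        Interlaced X S r p q c (restrict D (c + 1) T) (diagEntry S r p q c T) := by
  have hmono : ∀ {b}, b ∈ upperPart D (c + 1) → b ∈ upperPart D c := by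
    intro b hb
    rw [mem_upperPart] at hb ⊢
    exact ⟨hb.1, by lia⟩
  have hres : ∀ {b}, b ∈ upperPart D (c + 1) → restrict D (c + 1) T b = T b :=
    fun hb => if_pos hb
  constructor
  · intro hT
    refine ⟨⟨?_, ?_, fun b hb => if_neg hb⟩, ?_⟩
    · intro b hb hb'
      rw [hres hb, hres hb']
      exact hT.1 b (hmono hb) (hmono hb')
    · intro b hb hb'
      rw [hres hb, hres hb']
      exact hT.2.1 b (hmono hb) (hmono hb')
    · intro j k
      by_cases hj : p j.1 = c + 1
      · simp only [diagEntry, if_pos hj, h.pos_le_of_start hj k.2.1 k.2.2, iff_true]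
        simp [extRel]
      by_cases hk : q k.1 = c
      · simp only [nextEntry, if_pos hk, h.pos_le_of_terminal hk j.2.1 j.2.2, iff_true]
        simp [extRel]
      rw [h.nextEntry_restrict k hk, diagEntry, if_neg hj]
      have hx := h.mem j.1 c (by have := j.2.1; lia) j.2.2
      have hy := h.mem k.1 (c + 1) k.2.1 (by have := k.2.2; lia)
      have hr := h.rowLE_of_row_le hT hx hy (by simp [stripBox]) (by simp [stripBox])
      have hl := h.colLE_of_row_lt hT hx hy (by simp [stripBox]) (by simp [stripBox])
      simp only [extRel, stripRel, pos]
      rcases h.step c with hs | hs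
      · simp only [if_pos hs]
        simp only [stripBox, hs] at hr hl ⊢
        refine ⟨fun h1 => ?_, fun h1 => hr (by lia)⟩
        by_contra h2
        exact not_colLE.2 h1 (hl (by lia))
      · simp only [if_neg (show S (c + 1) ≠ S c by lia)]
        simp only [stripBox, hs] at hr hl ⊢
        refine ⟨fun h1 => ?_, fun h1 => hl (by lia)⟩
        by_contra h2
        exact not_colLE.2 (hr (by lia)) h1
  · rintro ⟨hT, hI⟩
    have key : ∀ x y : Box, x ∈ D → y ∈ D → x.2 - x.1 = c → y.2 - y.1 = c + 1 →
        ∃ u v : ℤ, x.1 = u + S c ∧ y.1 = v + S (c + 1) ∧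
          (stripRel X S c (T x) (T y) ↔ pos S c v ≤ pos S c u) := by
      intro x y hx hy hxc hyc
      obtain ⟨j, hj1, hj2, hj3⟩ := h.cover x hx
      obtain ⟨k, hk1, hk2, hk3⟩ := h.cover y hy
      rw [hxc] at hj1 hj2 hj3
      rw [hyc] at hk1 hk2 hk3
      refine ⟨r j, r k, congrArg Prod.fst hj3, congrArg Prod.fst hk3, ?_⟩
      have := hI ⟨j, by lia, hj2⟩ ⟨k, hk1, by lia⟩
      rw [h.nextEntry_restrict _ (by dsimp; lia), diagEntry, if_neg (by dsimp; lia)] at this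
      simpa only [← hj3, ← hk3, extRel] using this
    refine ⟨?_, ?_, hdef⟩
    · intro b hb hb'
      rw [mem_upperPart] at hb hb'
      rcases hb.2.eq_or_lt with hc | hc
      · obtain ⟨u, v, hu, hv, huv⟩ := key b _ hb.1 hb'.1 hc.symm (by dsimp; lia)
        dsimp only at hv
        rcases h.step c with hs | hs
        · rw [stripRel, if_pos hs, pos, pos, if_pos hs, if_pos hs] at huv
          exact huv.2 (by lia)
        · have hs' : S (c + 1) ≠ S c := by lia
          rw [stripRel, if_neg hs', pos, pos, if_neg hs', if_neg hs'] at huv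
          exact not_colLE.1 fun h1 => by have := huv.1 h1; lia
      · have h1 : b ∈ upperPart D (c + 1) := mem_upperPart.2 ⟨hb.1, hc⟩
        have h2 : (b.1, b.2 + 1) ∈ upperPart D (c + 1) :=
          mem_upperPart.2 ⟨hb'.1, by dsimp; lia⟩
        simpa only [hres h1, hres h2] using hT.1 b h1 h2
    · intro b hb hb'
      rw [mem_upperPart] at hb hb'
      dsimp only at hb'
      rcases hb'.2.eq_or_lt with hc | hc
      · obtain ⟨u, v, hu, hv, huv⟩ := key _ b hb'.1 hb.1 hc.symm (by lia)
        dsimp only at hu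
        rcases h.step c with hs | hs
        · rw [stripRel, if_pos hs, pos, pos, if_pos hs, if_pos hs] at huv
          by_contra h1
          have := huv.1 (not_colLE.1 h1)
          lia
        · have hs' : S (c + 1) ≠ S c := by lia
          rw [stripRel, if_neg hs', pos, pos, if_neg hs', if_neg hs'] at huv
          exact huv.2 (by lia)
      · have h1 : b ∈ upperPart D (c + 1) := mem_upperPart.2 ⟨hb.1, by lia⟩
        have h2 : (b.1 + 1, b.2) ∈ upperPart D (c + 1) :=
          mem_upperPart.2 ⟨hb'.1, by dsimp; lia⟩
        simpa only [hres h1, hres h2] using hT.2.1 b h1 h2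

variable [Fintype A]

omit [Inhabited A] in
/-- In a nonzero term of the transition, precisely the strips starting at content `c + 1` have no
entry of content `c`. -/
theorem eq_none_iff_of_ne_zero (h : IsStripDecomposition S D r p q) {X : A → Prop} {w : A → R}
    {c : ℤ} {T : Box → A} {f : {k // Active p q c k} → Option A}
    (hI : Interlaced X S r p q c T f)
    (hne : activeDet X w S p q c (fun k => (f k).elim (birthVec R p c) (sourceVec X w S p c)) ≠ 0)
    (k : {k // Active p q c k}) : f k = none ↔ p k.1 = c + 1 := by
  have hmax : ∀ i k : {k // Active p q c k}, f i = none → p k.1 = c + 1 → i = k := by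
    intro i k hi hk
    have h1 := (hI i k).1 (by rw [hi]; trivial)
    have h2 := h.pos_le_of_start hk i.2.1 i.2.2
    exact Subtype.ext (h.eq_of_active i.2.1 i.2.2 k.2.1 k.2.2 (pos_inj.1 (le_antisymm h2 h1)))
  constructor
  · intro hk
    by_contra hpk
    have hb : birthVec R p c = 0 := by
      funext j
      refine if_neg fun hj => hpk ?_
      have := hmax k ⟨j, hj.le, by have := h.le j; lia⟩ hk hj
      rw [this]
      exact hj
    refine hne (AlternatingMap.map_coord_zero _ k ?_)
    rw [hk]
    exact hb
  · intro hpk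
    by_contra hk
    refine hne ?_
    rw [activeDet, detColumns_apply]
    refine Matrix.det_eq_zero_of_column_eq_zero k.1 fun i => ?_
    rw [Matrix.of_apply]
    by_cases hi : Active p q c i
    · rw [dif_pos hi]
      rcases hfi : f ⟨i, hi⟩ with _ | a
      · have := hmax _ k hfi hpk
        rw [this] at hfi
        exact absurd hfi hk
      · simp only [Option.elim, sourceVec]
        rw [aliveVec_of_lt (by lia), mul_zero]
    · rw [dif_neg hi]
      have := h.le i
      by_cases hci : c < p i
      · rw [if_pos hci, if_neg]
        intro he
        exact hi ⟨by lia, by lia⟩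
      · rw [if_neg hci]
        refine segSum_of_lt ?_
        by_contra h1
        exact hi ⟨by lia, by lia⟩

end Constancy

end IsStripDecomposition

namespace IsStripDecomposition

section Determinant

variable {A R : Type*} [LinearOrder A] [CommRing R] [Inhabited A]
variable {S : ℤ → ℤ} {D : Finset Box} {m : ℕ} {r p q : Fin m → ℤ}

theorem prod_upperPart (h : IsStripDecomposition S D r p q) (v : Box → R) (c : ℤ) :
    ∏ b ∈ upperPart D c, v b = (∏ b ∈ upperPart D (c + 1), v b) *
      ∏ k : {k // Active p q c k}, if p k.1 = c + 1 then 1 else v (stripBox S (r k.1) c) := by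
  have hsub : upperPart D (c + 1) ⊆ upperPart D c := by
    intro b hb
    rw [mem_upperPart] at hb ⊢
    exact ⟨hb.1, by lia⟩
  rw [← Finset.prod_sdiff hsub, mul_comm]
  congr 1
  rw [Finset.prod_ite, Finset.prod_const_one, one_mul]
  symm
  refine Finset.prod_nbij (fun k => stripBox S (r k.1) c) ?_ ?_ ?_ fun _ _ => rfl
  · intro k hk
    rw [Finset.mem_filter] at hk
    have := k.2.1
    rw [Finset.mem_sdiff, mem_upperPart, mem_upperPart]
    exact ⟨⟨h.mem _ _ (by lia) k.2.2, by simp [stripBox]⟩, fun h1 => by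
      have := h1.2
      simp only [stripBox] at this
      lia⟩
  · intro j _ k _ hjk
    have hr : r j.1 = r k.1 := by
      have := congrArg Prod.fst hjk
      simpa [stripBox] using this
    exact Subtype.ext (h.eq_of_active j.2.1 j.2.2 k.2.1 k.2.2 hr)
  · intro b hb
    rw [Finset.mem_coe, Finset.mem_sdiff, mem_upperPart, mem_upperPart] at hb
    have hc : b.2 - b.1 = c := by
      have h1 := hb.1.2
      have h2 := fun h2 => hb.2 ⟨hb.1.1, h2⟩
      lia
    obtain ⟨k, h1, h2, h3⟩ := h.cover b hb.1.1
    rw [hc] at h1 h2 h3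
    exact ⟨⟨k, by lia, h2⟩, by simp; lia, h3.symm⟩

variable [Fintype A]

omit [Inhabited A] in
theorem activeDet_diagEntry (X : A → Prop) (w : A → R) (S : ℤ → ℤ) (r p q : Fin m → ℤ) (c : ℤ)
    (T : Box → A) :
    activeDet X w S p q c
        (fun k => (diagEntry S r p q c T k).elim (birthVec R p c) (sourceVec X w S p c)) =
      (∏ k : {k // Active p q c k}, if p k.1 = c + 1 then 1 else w (T (stripBox S (r k.1) c))) *
        (Matrix.of (column X w S r p q c T)).det := by
  have h1 : (fun k => (diagEntry S r p q c T k).elim (birthVec R p c) (sourceVec X w S p c)) =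
      fun k : {k // Active p q c k} =>
        (if p k.1 = c + 1 then 1 else w (T (stripBox S (r k.1) c))) •
          column X w S r p q c T k.1 := by
    funext k j
    have := k.2.1
    simp only [diagEntry, Pi.smul_apply, smul_eq_mul, column]
    split_ifs with h1 h2 h3 h4 <;> first | exact absurd k.2.2 ‹_› | lia | skip
    all_goals simp_all [birthVec, sourceVec]
  rw [h1, AlternatingMap.map_smul_univ, smul_eq_mul, activeDet, detColumns_apply]
  congr 3
  funext k j
  by_cases hk : Active p q c k
  · rw [dif_pos hk]
  · rw [dif_neg hk, column]
    by_cases hc : c < p k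
    · rw [if_pos hc, if_pos hc]
    · rw [if_neg hc, if_neg hc, if_neg fun hq => hk ⟨by lia, hq⟩]

/-- The sum over the fillings of the boxes of content at least `c`, weighted by the determinant
accounting for the remaining boxes. -/
def partialSum (X : A → Prop) (w : A → R) (S : ℤ → ℤ) (D : Finset Box) (r p q : Fin m → ℤ)
    (c : ℤ) : R :=
  ∑ T ∈ fillings X (upperPart D c), (∏ b ∈ upperPart D c, w (T b)) *
    (Matrix.of (column X w S r p q c T)).det

omit [LinearOrder A] [Fintype A] in
theorem eq_of_restrict_eq (h : IsStripDecomposition S D r p q) {c : ℤ} {T T' : Box → A}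
    (hT : ∀ b ∉ upperPart D c, T b = default) (hT' : ∀ b ∉ upperPart D c, T' b = default)
    (h1 : restrict D (c + 1) T = restrict D (c + 1) T')
    (h2 : diagEntry S r p q c T = diagEntry S r p q c T') : T = T' := by
  funext b
  by_cases hb : b ∈ upperPart D c
  · rw [mem_upperPart] at hb
    rcases hb.2.eq_or_lt with hc | hc
    · obtain ⟨k, hk1, hk2, hk3⟩ := h.cover b hb.1
      rw [← hc] at hk1 hk2 hk3
      have := congrFun h2 ⟨k, by lia, hk2⟩
      rw [diagEntry, diagEntry, if_neg (by dsimp; lia), if_neg (by dsimp; lia)] at this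
      rw [hk3]
      exact Option.some.inj this
    · rw [← restrict_of_mem (T := T) hb.1 hc, h1, restrict_of_mem hb.1 hc]
  · rw [hT b hb, hT' b hb]

open scoped Classical in
omit [LinearOrder A] [Fintype A] in
theorem exists_restrict_eq (h : IsStripDecomposition S D r p q) {c : ℤ} {T : Box → A}
    (hT : ∀ b ∉ upperPart D (c + 1), T b = default) {f : {k // Active p q c k} → Option A}
    (hf : ∀ k, f k = none ↔ p k.1 = c + 1) :
    ∃ T' : Box → A, (∀ b ∉ upperPart D c, T' b = default) ∧ restrict D (c + 1) T' = T ∧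
      diagEntry S r p q c T' = f := by
  refine ⟨fun b => if b ∈ upperPart D (c + 1) then T b else
    if hb : ∃ k : {k // Active p q c k}, p k.1 ≤ c ∧ b = stripBox S (r k.1) c then
      (f hb.choose).getD default else default, ?_, ?_, ?_⟩
  · intro b hb
    dsimp only
    rw [if_neg, dif_neg]
    · rintro ⟨k, hk, rfl⟩
      exact hb (mem_upperPart.2 ⟨h.mem _ _ hk k.2.2, by simp [stripBox]⟩)
    · intro h1
      rw [mem_upperPart] at hb h1
      exact hb ⟨h1.1, by lia⟩
  · funext b
    rw [restrict]
    split_ifs with hb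
    · rfl
    · exact (hT b hb).symm
  · funext k
    rw [diagEntry]
    split_ifs with hk1 hk2 hk3
    · exact ((hf k).2 hk1).symm
    · rw [mem_upperPart] at hk2
      have := hk2.2
      simp only [stripBox] at this
      lia
    · have hs := hk3.choose_spec.2
      have hr : r hk3.choose.1 = r k.1 := by
        have := congrArg Prod.fst hs
        simpa [stripBox] using this.symm
      have he : hk3.choose = k := Subtype.ext (h.eq_of_active hk3.choose.2.1 hk3.choose.2.2
        k.2.1 k.2.2 hr)
      rw [he]
      rcases hfk : f k with _ | a
      · exact absurd ((hf k).1 hfk) hk1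
      · rfl
    · exact absurd ⟨k, by have := k.2.1; lia, rfl⟩ hk3

theorem partialSum_succ (h : IsStripDecomposition S D r p q) (X : A → Prop) (w : A → R) (c : ℤ) :
    partialSum X w S D r p q c = partialSum X w S D r p q (c + 1) := by
  classical
  have hR : partialSum X w S D r p q (c + 1) =
      ∑ x ∈ fillings X (upperPart D (c + 1)) ×ˢ
          (Finset.univ : Finset ({k // Active p q c k} → Option A)),
        (∏ b ∈ upperPart D (c + 1), w (x.1 b)) * if Interlaced X S r p q c x.1 x.2 then
          activeDet X w S p q c (fun k => (x.2 k).elim (birthVec R p c) (sourceVec X w S p c))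
          else 0 := by
    rw [Finset.sum_product]
    refine Finset.sum_congr rfl fun T hT => ?_
    rw [h.det_column_transition X w c T (mem_fillings.1 hT), Finset.mul_sum]
  rw [hR, partialSum]
  refine Finset.sum_of_injOn (fun T => (restrict D (c + 1) T, diagEntry S r p q c T))
    ?_ ?_ ?_ ?_
  · intro T hT T' hT' he
    rw [Finset.mem_coe, mem_fillings] at hT hT'
    exact h.eq_of_restrict_eq hT.2.2 hT'.2.2 (congrArg Prod.fst he) (congrArg Prod.snd he)
  · intro T hT
    rw [Finset.mem_coe, mem_fillings] at hT
    rw [Finset.mem_coe, Finset.mem_product, mem_fillings]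
    exact ⟨((h.isFilling_upperPart_iff hT.2.2).1 hT).1, Finset.mem_univ _⟩
  · rintro ⟨T, f⟩ hx hn
    rw [Finset.mem_product, mem_fillings] at hx
    by_contra hne
    have hI : Interlaced X S r p q c T f := by
      by_contra hI
      exact hne (by rw [if_neg hI, mul_zero])
    rw [if_pos hI] at hne
    obtain ⟨T', h1, h2, h3⟩ := h.exists_restrict_eq hx.1.2.2
      (h.eq_none_iff_of_ne_zero hI (right_ne_zero_of_mul hne))
    refine hn ⟨T', ?_, Prod.ext h2 h3⟩
    rw [Finset.mem_coe, mem_fillings, h.isFilling_upperPart_iff h1, h2, h3]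
    exact ⟨hx.1, hI⟩
  · intro T hT
    rw [mem_fillings] at hT
    rw [if_pos ((h.isFilling_upperPart_iff hT.2.2).1 hT).2, activeDet_diagEntry, ← mul_assoc,
      h.prod_upperPart]
    refine congrArg (· * _ * _) (Finset.prod_congr rfl fun b hb => ?_)
    rw [mem_upperPart] at hb
    exact congrArg w (restrict_of_mem hb.1 hb.2).symm

theorem partialSum_eq (h : IsStripDecomposition S D r p q) (X : A → Prop) (w : A → R) (c : ℤ)
    (n : ℕ) : partialSum X w S D r p q c = partialSum X w S D r p q (c + n) := by
  induction n with
  | zero => simp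
  | succ n ih => rw [ih, h.partialSum_succ]; push_cast; rw [add_assoc]

theorem p_injective (h : IsStripDecomposition S D r p q) : Function.Injective p := by
  intro j k hjk
  have hj := h.le j
  have hk := h.le k
  have h1 := h.pos_le_of_start (c := p j - 1) (j := j) (k := k) (by lia) (by lia) (by lia)
  have h2 := h.pos_le_of_start (c := p j - 1) (j := k) (k := j) (by lia) (by lia) (by lia)
  exact h.eq_of_active (c := p j - 1) (by lia) (by lia) (by lia) (by lia)
    (pos_inj.1 (le_antisymm h2 h1))

/-- The generating function of the fillings of `D` is a determinant in those of the segments of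
the strip. -/
theorem fillSum_eq_det (h : IsStripDecomposition S D r p q) (X : A → Prop) (w : A → R) :
    fillSum X w D = (Matrix.of fun k j => segSum X w S (p j) (q k)).det := by
  classical
  obtain ⟨N, hN⟩ : ∃ N : ℕ, (∀ k, -(N : ℤ) < p k ∧ q k < N) ∧
      ∀ b ∈ D, -(N : ℤ) ≤ b.2 - b.1 ∧ b.2 - b.1 < N := by
    refine ⟨∑ k, ((p k).natAbs + (q k).natAbs) + ∑ b ∈ D, (b.2 - b.1).natAbs + 1, ?_, ?_⟩
    · intro k
      have := Finset.single_le_sum (f := fun k => (p k).natAbs + (q k).natAbs)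
        (fun _ _ => Nat.zero_le _) (Finset.mem_univ k)
      lia
    · intro b hb
      have := Finset.single_le_sum (f := fun b : Box => (b.2 - b.1).natAbs)
        (fun _ _ => Nat.zero_le _) hb
      lia
  have hlow : upperPart D (-N) = D := by
    ext b
    rw [mem_upperPart]
    exact ⟨fun h => h.1, fun hb => ⟨hb, (hN.2 b hb).1⟩⟩
  have hhigh : upperPart D N = ∅ := by
    refine Finset.eq_empty_of_forall_notMem fun b hb => ?_
    rw [mem_upperPart] at hb
    have := hN.2 b hb.1
    lia
  have h1 : partialSum X w S D r p q (-N) = fillSum X w D := by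
    rw [partialSum, hlow, fillSum]
    refine Finset.sum_congr rfl fun T _ => ?_
    have : Matrix.of (column X w S r p q (-N) T) = 1 := by
      ext k j
      rw [Matrix.of_apply, column, if_pos (hN.1 k).1, Matrix.one_apply]
      exact if_congr ⟨fun e => (h.p_injective e).symm, fun e => by rw [e]⟩ rfl rfl
    rw [this, Matrix.det_one, mul_one]
  rw [← h1, h.partialSum_eq X w (-N) (N + N), partialSum,
    show -(N : ℤ) + ((N + N : ℕ) : ℤ) = N by push_cast; ring, hhigh, fillings_empty,
    Finset.sum_singleton, Finset.prod_empty, one_mul]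
  congr 2
  funext k j
  have := hN.1 k
  have hk := h.le k
  rw [column, if_neg (by lia), if_neg (by lia)]

end Determinant

end IsStripDecomposition

/-- The segment of contents `p, …, q` of the strip whose box of content `c` lies in row `S c`. -/
def ribbon (S : ℤ → ℤ) (p q : ℤ) : Finset Box := (Finset.Icc p q).image (stripBox S 0)

theorem mem_ribbon {S : ℤ → ℤ} {p q : ℤ} {b : Box} :
    b ∈ ribbon S p q ↔ p ≤ b.2 - b.1 ∧ b.2 - b.1 ≤ q ∧ b.1 = S (b.2 - b.1) := by
  simp only [ribbon, Finset.mem_image, Finset.mem_Icc, stripBox]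
  constructor
  · rintro ⟨c, hc, rfl⟩
    simpa using hc
  · intro h
    refine ⟨b.2 - b.1, ⟨h.1, h.2.1⟩, ?_⟩
    rw [← h.2.2]
    ext <;> dsimp <;> ring

theorem antitone_of_step {S : ℤ → ℤ} (hS : ∀ c, S (c + 1) = S c ∨ S (c + 1) = S c - 1) :
    Antitone S :=
  antitone_int_of_succ_le fun c => by have := hS c; lia

theorem monotone_add_of_step {S : ℤ → ℤ} (hS : ∀ c, S (c + 1) = S c ∨ S (c + 1) = S c - 1) :
    Monotone fun c => S c + c :=
  monotone_int_of_le_succ fun c => by have := hS c; lia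

theorem ordConnected_ribbon {S : ℤ → ℤ} (hS : ∀ c, S (c + 1) = S c ∨ S (c + 1) = S c - 1)
    (p q : ℤ) : (ribbon S p q : Set Box).OrdConnected := by
  refine ⟨fun x hx z hz y hy => ?_⟩
  rw [Finset.mem_coe, mem_ribbon] at hx hz ⊢
  obtain ⟨⟨h1, h2⟩, ⟨h3, h4⟩⟩ := hy
  have ha : ∀ {c d}, c ≤ d → S d ≤ S c := fun h => antitone_of_step hS h
  have hm : ∀ {c d}, c ≤ d → S c + c ≤ S d + d := fun h => monotone_add_of_step hS h
  rcases le_total (x.2 - x.1) (z.2 - z.1) with h | h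
  · have := ha h
    have h5 := ha (c := x.2 - x.1) (d := y.2 - y.1) (by lia)
    have h6 := ha (c := y.2 - y.1) (d := z.2 - z.1) (by lia)
    lia
  · have := hm h
    have h5 := hm (c := z.2 - z.1) (d := y.2 - y.1) (by lia)
    have h6 := hm (c := y.2 - y.1) (d := x.2 - x.1) (by lia)
    lia

theorem isStripDecomposition_ribbon {S : ℤ → ℤ}
    (hS : ∀ c, S (c + 1) = S c ∨ S (c + 1) = S c - 1) {p q : ℤ} (hpq : p ≤ q) :
    IsStripDecomposition S (ribbon S p q) (fun _ : Fin 1 => 0) (fun _ => p) (fun _ => q) where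
  step := hS
  convex := ordConnected_ribbon hS p q
  le _ := hpq
  mem _ c h1 h2 := by simp [mem_ribbon, stripBox, h1, h2]
  cover b hb := by
    rw [mem_ribbon] at hb
    refine ⟨0, hb.1, hb.2.1, ?_⟩
    rw [stripBox, ← hb.2.2]
    ext <;> dsimp <;> ring
  unique _ _ _ _ _ _ _ _ := Subsingleton.elim _ _
  initial _ := by simp [mem_ribbon, stripBox]
  terminal _ := by simp [mem_ribbon, stripBox]

theorem fillSum_ribbon {A R : Type*} [LinearOrder A] [Fintype A] [Inhabited A] [CommRing R]
    (X : A → Prop) (w : A → R) {S : ℤ → ℤ} (hS : ∀ c, S (c + 1) = S c ∨ S (c + 1) = S c - 1)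
    {p q : ℤ} (hpq : p ≤ q) : fillSum X w (ribbon S p q) = segSum X w S p q := by
  rw [(isStripDecomposition_ribbon hS hpq).fillSum_eq_det, Matrix.det_fin_one, Matrix.of_apply]

theorem fillSum_empty {A R : Type*} [LinearOrder A] [Fintype A] [Inhabited A] [CommRing R]
    (X : A → Prop) (w : A → R) : fillSum X w ∅ = 1 := by
  rw [fillSum, fillings_empty, Finset.sum_singleton, Finset.prod_empty]

theorem segSum_eq_ite {A R : Type*} [LinearOrder A] [Fintype A] [Inhabited A] [CommRing R]
    (X : A → Prop) (w : A → R) {S : ℤ → ℤ} (hS : ∀ c, S (c + 1) = S c ∨ S (c + 1) = S c - 1)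
    (p q : ℤ) : segSum X w S p q = if p ≤ q + 1 then fillSum X w (ribbon S p q) else 0 := by
  rcases lt_trichotomy p (q + 1) with h | h | h
  · rw [if_pos h.le, fillSum_ribbon X w hS (by lia)]
  · rw [if_pos h.le, segSum_of_eq h, ribbon, Finset.Icc_eq_empty (by lia), Finset.image_empty,
      fillSum_empty]
  · rw [if_neg (by lia), segSum_of_lt h]

theorem ordConnected_skewCells (lam mu : Partition') : (skewCells lam mu).OrdConnected := by
  refine ⟨fun x hx z hz y hy => ?_⟩
  obtain ⟨⟨h1, h2⟩, ⟨h3, h4⟩⟩ := hy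
  obtain ⟨hx1, hx2, -⟩ := hx
  obtain ⟨-, -, hz3⟩ := hz
  have hmu := mu.antitone (Int.toNat_le_toNat h1)
  have hlam := lam.antitone (Int.toNat_le_toNat h3)
  exact ⟨by lia, by lia, by lia⟩

theorem finite_skewCells (lam mu : Partition') : (skewCells lam mu).Finite := by
  obtain ⟨N, hN⟩ := lam.eventually_zero
  refine (Set.finite_Icc ((1, 0) : Box) (N, lam.part 0)).subset ?_
  rintro ⟨i, j⟩ ⟨h1, h2, h3⟩
  dsimp only at h1 h2 h3
  have h4 := lam.antitone (Nat.zero_le i.toNat)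
  have h5 : ¬ N ≤ i.toNat := fun h => by
    have := hN _ h
    lia
  exact ⟨⟨h1, by dsimp; lia⟩, ⟨by dsimp; lia, by dsimp; lia⟩⟩

theorem IsSkewShape.ordConnected {D : Set Box} (h : IsSkewShape D) : D.OrdConnected := by
  obtain ⟨lam, mu, -, rfl⟩ := h
  exact ordConnected_skewCells lam mu

theorem IsSkewShape.finite {D : Set Box} (h : IsSkewShape D) : D.Finite := by
  obtain ⟨lam, mu, -, rfl⟩ := h
  exact finite_skewCells lam mu

theorem IsSkewLike.ordConnected {D : Set Box} (h : IsSkewLike D) : D.OrdConnected := by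
  obtain ⟨v, hv⟩ := h
  refine ⟨fun x hx z hz y hy => ?_⟩
  obtain ⟨y', hy', he⟩ := hv.ordConnected.out (Set.mem_image_of_mem _ hx)
    (Set.mem_image_of_mem _ hz) ⟨add_le_add_left hy.1 v, add_le_add_left hy.2 v⟩
  rwa [← add_right_cancel he]

namespace IsBorderStrip

variable {B : Set Box}

theorem eq_of_content_eq (h : IsBorderStrip B) {x y : Box} (hx : x ∈ B) (hy : y ∈ B)
    (hxy : x.2 - x.1 = y.2 - y.1) : x = y := by
  have key : ∀ x y : Box, x ∈ B → y ∈ B → x.2 - x.1 = y.2 - y.1 → ¬ x.1 < y.1 := by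
    intro x y hx hy hxy hlt
    have hB := h.2.1.ordConnected
    refine h.2.2.2 x ⟨hx, ?_, ?_, ?_⟩ <;>
    exact hB.out hx hy ⟨⟨by dsimp; lia, by dsimp; lia⟩, ⟨by dsimp; lia, by dsimp; lia⟩⟩
  have h1 := key x y hx hy hxy
  have h2 := key y x hy hx hxy.symm
  ext <;> lia

theorem right_or_up (h : IsBorderStrip B) {x y : Box} (hx : x ∈ B) (hy : y ∈ B)
    (hlt : x.2 - x.1 < y.2 - y.1) : (x.1, x.2 + 1) ∈ B ∨ (x.1 - 1, x.2) ∈ B := by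
  have key : ∀ z, Relation.ReflTransGen (fun x y => x ∈ B ∧ y ∈ B ∧ boxAdj x y) x z →
      z.2 - z.1 ≤ x.2 - x.1 ∨ (x.1, x.2 + 1) ∈ B ∨ (x.1 - 1, x.2) ∈ B := by
    intro z hz
    induction hz with
    | refl => exact Or.inl le_rfl
    | @tail u v _ huv ih =>
      obtain ⟨hu, hv, ha⟩ := huv
      refine ih.elim (fun ih => ?_) Or.inr
      by_contra! hn
      have hux : u = x := h.eq_of_content_eq hu hx (by
        unfold boxAdj at ha
        lia)
      subst hux
      rcases ha with ⟨h1, h2 | h2⟩ | ⟨h1, h2 | h2⟩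
      · lia
      · exact hn.2.1 (by rwa [h1, ← h2])
      · exact hn.2.2 (by rwa [h1, h2, add_sub_cancel_right])
      · lia
  exact (key y (h.2.2.1 x hx y hy)).resolve_left (by lia)

theorem left_or_down (h : IsBorderStrip B) {x y : Box} (hx : x ∈ B) (hy : y ∈ B)
    (hlt : y.2 - y.1 < x.2 - x.1) : (x.1, x.2 - 1) ∈ B ∨ (x.1 + 1, x.2) ∈ B := by
  have key : ∀ z, Relation.ReflTransGen (fun x y => x ∈ B ∧ y ∈ B ∧ boxAdj x y) x z →
      x.2 - x.1 ≤ z.2 - z.1 ∨ (x.1, x.2 - 1) ∈ B ∨ (x.1 + 1, x.2) ∈ B := by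
    intro z hz
    induction hz with
    | refl => exact Or.inl le_rfl
    | @tail u v _ huv ih =>
      obtain ⟨hu, hv, ha⟩ := huv
      refine ih.elim (fun ih => ?_) Or.inr
      by_contra! hn
      have hux : u = x := h.eq_of_content_eq hu hx (by
        unfold boxAdj at ha
        lia)
      subst hux
      rcases ha with ⟨h1, h2 | h2⟩ | ⟨h1, h2 | h2⟩
      · exact hn.2.1 (by rwa [h1, h2, add_sub_cancel_right])
      · lia
      · lia
      · exact hn.2.2 (by rwa [h1, ← h2])
  exact (key y (h.2.2.1 x hx y hy)).resolve_left (by lia)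

/-- A border strip is a segment of a strip. -/
theorem exists_rows (h : IsBorderStrip B) {p q : ℤ} (hp : ∃ b ∈ B, b.2 - b.1 = p)
    (hq : ∃ b ∈ B, b.2 - b.1 = q) (hB : ∀ b ∈ B, p ≤ b.2 - b.1 ∧ b.2 - b.1 ≤ q) :
    ∃ S : ℤ → ℤ, (∀ c, S (c + 1) = S c ∨ S (c + 1) = S c - 1) ∧
      ∀ b, b ∈ B ↔ p ≤ b.2 - b.1 ∧ b.2 - b.1 ≤ q ∧ b.1 = S (b.2 - b.1) := by
  obtain ⟨y, hy, hyq⟩ := hq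
  have hpq : p ≤ q := hyq ▸ (hB y hy).1
  have hex : ∀ n : ℕ, p + n ≤ q → ∃ b ∈ B, b.2 - b.1 = p + n := by
    intro n
    induction n with
    | zero => simpa using fun _ => hp
    | succ n ih =>
      intro hn
      obtain ⟨b, hb, hbn⟩ := ih (by lia)
      rcases h.right_or_up hb hy (by lia) with h1 | h1
      · exact ⟨_, h1, by dsimp; lia⟩
      · exact ⟨_, h1, by dsimp; lia⟩
  have hex' : ∀ c : ℤ, ∃ b ∈ B, b.2 - b.1 = max p (min c q) := by
    intro c
    obtain ⟨b, hb, hbc⟩ := hex (max p (min c q) - p).toNat (by lia)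
    exact ⟨b, hb, by lia⟩
  choose f hf hfc using hex'
  refine ⟨fun c => (f c).1, fun c => ?_, fun b => ⟨fun hb => ?_, fun hb => ?_⟩⟩
  · have h1 := hfc c
    have h2 := hfc (c + 1)
    by_cases hc : p ≤ c ∧ c < q
    · rcases h.right_or_up (hf c) (hf (c + 1)) (by lia) with h3 | h3
      · have := h.eq_of_content_eq h3 (hf (c + 1)) (by dsimp; lia)
        exact Or.inl (congrArg Prod.fst this).symm
      · have := h.eq_of_content_eq h3 (hf (c + 1)) (by dsimp; lia)
        exact Or.inr (congrArg Prod.fst this).symm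
    · have := h.eq_of_content_eq (hf c) (hf (c + 1)) (by lia)
      exact Or.inl (congrArg Prod.fst this).symm
  · have hc := hB b hb
    refine ⟨hc.1, hc.2, ?_⟩
    exact congrArg Prod.fst
      (h.eq_of_content_eq hb (hf (b.2 - b.1)) (by have := hfc (b.2 - b.1); lia))
  · have := hfc (b.2 - b.1)
    have hb' : b = f (b.2 - b.1) := by ext <;> dsimp only at hb this <;> lia
    rw [hb']
    exact hf _

theorem content_le_of_isEndBox (h : IsBorderStrip B) {b x : Box} (hb : IsEndBox B b) (hx : x ∈ B) :
    x.2 - x.1 ≤ b.2 - b.1 := by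
  by_contra hlt
  rcases h.right_or_up hb.1 hx (not_le.1 hlt) with h1 | h1
  · exact hb.2.2 h1
  · exact hb.2.1 h1

theorem le_content_of_isStartBox (h : IsBorderStrip B) {b x : Box} (hb : IsStartBox B b)
    (hx : x ∈ B) : b.2 - b.1 ≤ x.2 - x.1 := by
  by_contra hlt
  rcases h.left_or_down hb.1 hx (not_le.1 hlt) with h1 | h1
  · exact hb.2.1 h1
  · exact hb.2.2 h1

theorem exists_rows_of_hasPQ (h : IsBorderStrip B) {p q : ℤ} (hpq : HasPQ B p q) :
    ∃ S : ℤ → ℤ, (∀ c, S (c + 1) = S c ∨ S (c + 1) = S c - 1) ∧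
      ∀ b, b ∈ B ↔ p ≤ b.2 - b.1 ∧ b.2 - b.1 ≤ q ∧ b.1 = S (b.2 - b.1) := by
  obtain ⟨⟨x, hx, rfl⟩, ⟨y, hy, rfl⟩⟩ := hpq
  exact h.exists_rows ⟨x, hx.1, rfl⟩ ⟨y, hy.1, rfl⟩ fun b hb =>
    ⟨h.le_content_of_isStartBox hx hb, h.content_le_of_isEndBox hy hb⟩

theorem hasPQ_unique (h : IsBorderStrip B) {p q p' q' : ℤ} (hpq : HasPQ B p q)
    (hpq' : HasPQ B p' q') : p = p' ∧ q = q' := by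
  obtain ⟨⟨x, hx, rfl⟩, ⟨y, hy, rfl⟩⟩ := hpq
  obtain ⟨⟨x', hx', rfl⟩, ⟨y', hy', rfl⟩⟩ := hpq'
  exact ⟨le_antisymm (h.le_content_of_isStartBox hx hx'.1) (h.le_content_of_isStartBox hx' hx.1),
    le_antisymm (h.content_le_of_isEndBox hy' hy.1) (h.content_le_of_isEndBox hy hy'.1)⟩

end IsBorderStrip

theorem IsCuttingStripOf.exists_rows {D : Set Box} (hfin : D.Finite) (hne : D.Nonempty)
    {P : Set (Set Box)} {T : Set Box} (hT : IsCuttingStripOf D P T) :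
    ∃ (S : ℤ → ℤ) (p q : ℤ), (∀ c, S (c + 1) = S c ∨ S (c + 1) = S c - 1) ∧
      (∀ b, b ∈ T ↔ p ≤ b.2 - b.1 ∧ b.2 - b.1 ≤ q ∧ b.1 = S (b.2 - b.1)) ∧
      ∀ b ∈ D, p ≤ b.2 - b.1 ∧ b.2 - b.1 ≤ q := by
  obtain ⟨hB, hc, -⟩ := hT
  obtain ⟨x, hx, hxmin⟩ := hfin.exists_minimalFor boxContent D hne
  obtain ⟨y, hy, hymax⟩ := hfin.exists_maximalFor boxContent D hne
  have hD : ∀ b ∈ D, boxContent x ≤ b.2 - b.1 ∧ b.2 - b.1 ≤ boxContent y := by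
    intro b hb
    exact ⟨(le_total _ _).elim id fun h => hxmin hb h, (le_total _ _).elim id fun h => hymax hb h⟩
  have hTD : ∀ b ∈ D, ∃ t ∈ T, t.2 - t.1 = b.2 - b.1 := by
    intro b hb
    have : boxContent b ∈ boxContent '' T := hc ▸ Set.mem_image_of_mem _ hb
    exact this
  obtain ⟨S, hS, hST⟩ := hB.exists_rows (hTD x hx) (hTD y hy) fun b hb => by
    obtain ⟨d, hd, hdb⟩ : boxContent b ∈ boxContent '' D := hc ▸ Set.mem_image_of_mem _ hb
    have := hD d hd
    rw [show b.2 - b.1 = d.2 - d.1 from hdb.symm]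
    exact this
  exact ⟨S, _, _, hS, hST, hD⟩

section Geometry

variable {D : Set Box} {m : ℕ} {θ : Fin m → Set Box} {pθ qθ : Fin m → ℤ} {T : Set Box}

theorem IsOutsideDecomposition.eq_of_mem (hP : IsOutsideDecomposition D (Set.range θ)) {k : Fin m}
    {b : Box} (hb : b ∈ θ k) {s : Set Box} (hs : s ∈ Set.range θ) (hbs : b ∈ s) : s = θ k :=
  (hP.2.1 b ((hP.1 _ ⟨k, rfl⟩).2 hb)).unique ⟨hs, hbs⟩ ⟨⟨k, rfl⟩, hb⟩

/-- An outside decomposition consists of translates of segments of its cutting strip. -/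
theorem IsOutsideDecomposition.exists_isStripDecomposition (hD : IsSkewShape D)
    (hne : D.Nonempty) (hθinj : Function.Injective θ)
    (hP : IsOutsideDecomposition D (Set.range θ)) (hpq : ∀ i, HasPQ (θ i) (pθ i) (qθ i))
    (hT : IsCuttingStripOf D (Set.range θ) T) :
    ∃ (S : ℤ → ℤ) (r : Fin m → ℤ),
      IsStripDecomposition S hD.finite.toFinset r pθ qθ ∧
      ∀ i j, stripSegment T (pθ j) (qθ i) = (ribbon S (pθ j) (qθ i) : Set Box) := by
  obtain ⟨S, P, Q, hS, hST, hDPQ⟩ := hT.exists_rows hD.finite hne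
  choose ρ hρstep hρ using fun k => (hP.1 (θ k) ⟨k, rfl⟩).1.exists_rows_of_hasPQ (hpq k)
  have hsub : ∀ {k b}, b ∈ θ k → b ∈ D := fun {k _} hb => (hP.1 (θ k) ⟨k, rfl⟩).2 hb
  have hbox : ∀ {k c}, pθ k ≤ c → c ≤ qθ k → (ρ k c, ρ k c + c) ∈ θ k := by
    intro k c h1 h2
    rw [hρ]
    simp [h1, h2]
  have hle : ∀ k, pθ k ≤ qθ k := by
    intro k
    obtain ⟨b, hb⟩ := (hP.1 (θ k) ⟨k, rfl⟩).1.1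
    rw [hρ] at hb
    exact hb.1.trans hb.2.1
  have hPQ : ∀ {k c}, pθ k ≤ c → c ≤ qθ k → P ≤ c ∧ c ≤ Q := by
    intro k c h1 h2
    simpa using hDPQ _ (hsub (hbox h1 h2))
  have hTbox : ∀ {c}, P ≤ c → c ≤ Q → (S c, S c + c) ∈ T := by
    intro c h1 h2
    rw [hST]
    simp [h1, h2]
  have hup : ∀ b ∈ D, b.2 - b.1 + 1 ≤ Q → S (b.2 - b.1 + 1) = S (b.2 - b.1) - 1 →
      GoesUp D (Set.range θ) b := by
    intro b hb hQ hs
    have hb' := hDPQ b hb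
    refine ((hT.2.2 _ (hTbox hb'.1 hb'.2) b hb (by simp [boxContent])).1 ?_)
    rw [hST]
    dsimp only
    rw [show S (b.2 - b.1) + (b.2 - b.1) - (S (b.2 - b.1) - 1) = b.2 - b.1 + 1 by ring]
    exact ⟨by lia, hQ, hs.symm⟩
  have hright : ∀ b ∈ D, b.2 - b.1 + 1 ≤ Q → S (b.2 - b.1 + 1) = S (b.2 - b.1) →
      GoesRight D (Set.range θ) b := by
    intro b hb hQ hs
    have hb' := hDPQ b hb
    refine ((hT.2.2 _ (hTbox hb'.1 hb'.2) b hb (by simp [boxContent])).2 ?_)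
    rw [hST]
    dsimp only
    rw [show S (b.2 - b.1) + (b.2 - b.1) + 1 - S (b.2 - b.1) = b.2 - b.1 + 1 by ring]
    exact ⟨by lia, hQ, hs.symm⟩
  have hend : ∀ {k b}, b ∈ θ k → IsEndBox (θ k) b → b.2 - b.1 = qθ k := by
    intro k b hb he
    have h1 := (hρ k b).1 hb
    have h2 := (hP.1 (θ k) ⟨k, rfl⟩).1.content_le_of_isEndBox he (hbox (hle k) le_rfl)
    dsimp only at h2
    lia
  have hstep : ∀ k c, pθ k ≤ c → c < qθ k → ρ k (c + 1) - ρ k c = S (c + 1) - S c := by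
    intro k c h1 h2
    have hb := hbox h1 h2.le
    have hQ := (hPQ (k := k) (c := c + 1) (by lia) h2).2
    rcases hS c with hs | hs
    · obtain ⟨s, hs1, hs2, hs3⟩ := hright _ (hsub hb) (by simpa using hQ) (by simpa using hs)
      rw [hP.eq_of_mem hb hs1 hs2] at hs3
      rcases hs3 with hs3 | hs3
      · have := ((hρ k _).1 hs3).2.2
        dsimp only at this
        rw [show ρ k c + c + 1 - ρ k c = c + 1 by ring] at this
        lia
      · have := hend hb hs3.1
        dsimp only at this
        lia
    · obtain ⟨s, hs1, hs2, hs3⟩ := hup _ (hsub hb) (by simpa using hQ) (by simpa using hs)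
      rw [hP.eq_of_mem hb hs1 hs2] at hs3
      rcases hs3 with hs3 | hs3
      · have := ((hρ k _).1 hs3).2.2
        dsimp only at this
        rw [show ρ k c + c - (ρ k c - 1) = c + 1 by ring] at this
        lia
      · have := hend hb hs3.1
        dsimp only at this
        lia
  have hconst : ∀ k c, pθ k ≤ c → c ≤ qθ k → ρ k c = ρ k (pθ k) - S (pθ k) + S c := by
    intro k c h1
    obtain ⟨n, rfl⟩ : ∃ n : ℕ, c = pθ k + n := ⟨(c - pθ k).toNat, by lia⟩
    induction n with
    | zero => intro _; simp
    | succ n ih =>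
      intro h2
      have h3 := ih (by lia) (by lia)
      have h4 := hstep k (pθ k + n) (by lia) (by lia)
      push_cast
      rw [← add_assoc]
      lia
  have hstrip : ∀ {k c}, pθ k ≤ c → c ≤ qθ k →
      stripBox S (ρ k (pθ k) - S (pθ k)) c = (ρ k c, ρ k c + c) := by
    intro k c h1 h2
    rw [stripBox, hconst k c h1 h2]
  refine ⟨S, fun k => ρ k (pθ k) - S (pθ k), ⟨hS, ?_, hle, ?_, ?_, ?_, ?_, ?_⟩, ?_⟩
  · simpa using hD.ordConnected
  · intro k c h1 h2
    rw [Set.Finite.mem_toFinset, hstrip h1 h2]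
    exact hsub (hbox h1 h2)
  · intro b hb
    rw [Set.Finite.mem_toFinset] at hb
    obtain ⟨_, ⟨⟨k, rfl⟩, hk⟩, -⟩ := hP.2.1 b hb
    have hk' := (hρ k b).1 hk
    refine ⟨k, hk'.1, hk'.2.1, ?_⟩
    rw [hstrip hk'.1 hk'.2.1, ← hk'.2.2]
    ext <;> simp
  · intro k k' c h1 h2 h1' h2' hr
    have h3 := hbox h1 h2
    rw [← hstrip h1 h2, hr, hstrip h1' h2'] at h3
    exact (hθinj (hP.eq_of_mem h3 ⟨k', rfl⟩ (hbox h1' h2'))).symm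
  · intro k hmem
    rw [Set.Finite.mem_toFinset] at hmem
    set x := stripBox S (ρ k (pθ k) - S (pθ k)) (pθ k - 1) with hx
    have hxc : x.2 - x.1 = pθ k - 1 := by simp [hx, stripBox]
    have hxr : x.1 = ρ k (pθ k) - S (pθ k) + S (pθ k - 1) := rfl
    have hb := hbox le_rfl (hle k)
    have hQ := (hPQ le_rfl (hle k)).2
    have hno : ∀ s ∈ Set.range θ, x ∈ s → (ρ k (pθ k), ρ k (pθ k) + pθ k) ∉ s := by
      intro s hs hxs hbs
      rw [hP.eq_of_mem hb hs hbs, hρ] at hxs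
      lia
    rcases hS (pθ k - 1) with hs | hs
    · rw [sub_add_cancel] at hs
      have hr : (x.1, x.2 + 1) = (ρ k (pθ k), ρ k (pθ k) + pθ k) := by ext <;> dsimp <;> lia
      obtain ⟨s, hs1, hs2, hs3 | hs3⟩ := hright x hmem (by rw [hxc]; lia)
        (by rw [hxc, sub_add_cancel]; exact hs)
      · exact hno s hs1 hs2 (hr ▸ hs3)
      · rcases hP.2.2.2 s hs1 x hs3.1 with h1 | h1
        · exact h1 hs3.2
        · exact h1 (hr ▸ hsub hb)
    · rw [sub_add_cancel] at hs
      have hr : (x.1 - 1, x.2) = (ρ k (pθ k), ρ k (pθ k) + pθ k) := by ext <;> dsimp <;> lia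
      obtain ⟨s, hs1, hs2, hs3 | hs3⟩ := hup x hmem (by rw [hxc]; lia)
        (by rw [hxc, sub_add_cancel]; exact hs)
      · exact hno s hs1 hs2 (hr ▸ hs3)
      · exact hs3.2 (hr ▸ hsub hb)
  · intro k hmem
    rw [Set.Finite.mem_toFinset] at hmem
    have hb := hbox (hle k) le_rfl
    have hQ : qθ k + 1 ≤ Q := by simpa [stripBox] using (hDPQ _ hmem).2
    have hcon := hconst k (qθ k) (hle k) le_rfl
    have hnext : ∀ x ∈ θ k, x.2 - x.1 ≠ qθ k + 1 := fun x hx => by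
      have := (hρ k x).1 hx
      lia
    rcases hS (qθ k) with hs | hs
    · obtain ⟨s, hs1, hs2, hs3⟩ := hright _ (hsub hb) (by simpa using hQ) (by simpa using hs)
      rw [hP.eq_of_mem hb hs1 hs2] at hs3
      rcases hs3 with hs3 | hs3
      · exact hnext _ hs3 (by dsimp; ring)
      · rcases hP.2.2.2 _ ⟨k, rfl⟩ _ hs3.1 with h1 | h1
        · exact h1 hs3.2
        · refine h1 ?_
          convert hmem using 1
          ext <;> dsimp [stripBox] <;> lia
    · obtain ⟨s, hs1, hs2, hs3⟩ := hup _ (hsub hb) (by simpa using hQ) (by simpa using hs)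
      rw [hP.eq_of_mem hb hs1 hs2] at hs3
      rcases hs3 with hs3 | hs3
      · exact hnext _ hs3 (by dsimp; ring)
      · refine hs3.2 ?_
        convert hmem using 1
        ext <;> dsimp [stripBox] <;> lia
  · intro i j
    ext b
    rw [Finset.mem_coe, mem_ribbon]
    have h1 := hPQ le_rfl (hle j)
    have h2 := hPQ (hle i) le_rfl
    change (b ∈ T ∧ pθ j ≤ b.2 - b.1 ∧ b.2 - b.1 ≤ qθ i) ↔ _
    rw [hST]
    constructor
    · rintro ⟨⟨-, -, h3⟩, h4, h5⟩
      exact ⟨h4, h5, h3⟩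
    · rintro ⟨h4, h5, h3⟩
      exact ⟨⟨h1.1.trans h4, h5.trans h2.2, h3⟩, h4, h5⟩

end Geometry

section PowerSeries

/-- The power series whose coefficients at all exponents below `ν` vanish. -/
def truncIdeal {σ R : Type*} [CommRing R] (ν : σ →₀ ℕ) : Ideal (MvPowerSeries σ R) where
  carrier := {f | ∀ d ≤ ν, MvPowerSeries.coeff d f = 0}
  zero_mem' := fun _ _ => map_zero _
  add_mem' := fun hf hg d hd => by rw [map_add, hf d hd, hg d hd, add_zero]
  smul_mem' := fun f g hg d hd => by
    classical
    rw [smul_eq_mul, MvPowerSeries.coeff_mul]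
    refine Finset.sum_eq_zero fun x hx => ?_
    have hx' : x.2 ≤ d := le_add_self.trans_eq (Finset.HasAntidiagonal.mem_antidiagonal.1 hx)
    rw [hg x.2 (hx'.trans hd), mul_zero]

theorem mk_truncIdeal_eq_iff {σ R : Type*} [CommRing R] {ν : σ →₀ ℕ} {f g : MvPowerSeries σ R} :
    Ideal.Quotient.mk (truncIdeal ν) f = Ideal.Quotient.mk (truncIdeal ν) g ↔
      ∀ d ≤ ν, MvPowerSeries.coeff d f = MvPowerSeries.coeff d g := by
  rw [Ideal.Quotient.eq]
  change (∀ d ≤ ν, MvPowerSeries.coeff d (f - g) = 0) ↔ _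
  simp only [map_sub, sub_eq_zero]

theorem rowLE_isLeft_iff {s : Finset (ℕ ⊕ₗ ℕ)} {a b : s} :
    rowLE (fun a : s => (ofLex a.1).isLeft) a b ↔ entryLE (ofLex a.1) (ofLex b.1) ∧
      ∀ i j, ofLex a.1 = Sum.inr i → ofLex b.1 = Sum.inr j → i < j := by
  obtain ⟨a, ha⟩ := a
  obtain ⟨b, hb⟩ := b
  induction a using Lex.rec with | _ a
  induction b using Lex.rec with | _ b
  rcases a with a | a <;> rcases b with b | b <;>
    simp [rowLE, entryLE, Subtype.ext_iff, ← le_iff_lt_or_eq]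
  exact le_of_lt

theorem colLE_isLeft_iff {s : Finset (ℕ ⊕ₗ ℕ)} {a b : s} :
    colLE (fun a : s => (ofLex a.1).isLeft) a b ↔ entryLE (ofLex a.1) (ofLex b.1) ∧
      ∀ i j, ofLex a.1 = Sum.inl i → ofLex b.1 = Sum.inl j → i < j := by
  obtain ⟨a, ha⟩ := a
  obtain ⟨b, hb⟩ := b
  induction a using Lex.rec with | _ a
  induction b using Lex.rec with | _ b
  rcases a with a | a <;> rcases b with b | b <;>
    simp [colLE, entryLE, Subtype.ext_iff, ← le_iff_lt_or_eq]
  exact le_of_lt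

theorem isFilling_iff_isSuperSSYT {s : Finset (ℕ ⊕ₗ ℕ)} [Inhabited s]
    (hs : (default : s).1 = toLex (Sum.inl 0)) {B : Finset Box} {T : Box → s} :
    IsFilling (fun a : s => (ofLex a.1).isLeft) B T ↔
      IsSuperSSYT B fun b => ofLex (T b).1 := by
  have h0 : ∀ a : s, a = default ↔ ofLex a.1 = Sum.inl 0 := fun a => by
    rw [Subtype.ext_iff, hs]
    rfl
  simp only [IsFilling, IsSuperSSYT, rowLE_isLeft_iff, colLE_isLeft_iff, h0, Finset.mem_coe]
  grind

theorem forall_eq_ncard_iff {α β : Type*} (B : Finset α) (T : α → β) (ν : β →₀ ℕ) :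
    (∀ v, ν v = {b ∈ (B : Set α) | T b = v}.ncard) ↔ ν = ∑ b ∈ B, Finsupp.single (T b) 1 := by
  classical
  rw [DFunLike.ext_iff]
  refine forall_congr' fun v => ?_
  rw [Finsupp.finsetSum_apply]
  simp only [Finsupp.single_apply, Finset.sum_boole, Nat.cast_id]
  rw [← Set.ncard_coe_finset, Finset.coe_filter]
  rfl

theorem coeff_superSchur {s : Finset (ℕ ⊕ₗ ℕ)} [Inhabited s]
    (hs : (default : s).1 = toLex (Sum.inl 0)) (B : Finset Box) {ν : (ℕ ⊕ ℕ) →₀ ℕ}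
    (hν : ∀ v, ν v ≠ 0 → toLex v ∈ s) :
    MvPowerSeries.coeff ν (superSchur B) =
      MvPowerSeries.coeff ν (fillSum (fun a : s => (ofLex a.1).isLeft)
        (fun a => MvPowerSeries.X (ofLex a.1) : s → MvPowerSeries (ℕ ⊕ ℕ) ℤ) B) := by
  classical
  have hinj : Function.Injective fun (T : Box → s) b => ofLex (T b).1 := fun T T' h =>
    funext fun b => Subtype.ext (congrFun h b)
  have hset : {T : Box → ℕ ⊕ ℕ | IsSuperSSYT B T ∧
      ∀ v : ℕ ⊕ ℕ, ν v = {b ∈ (B : Set Box) | T b = v}.ncard} =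
      (fun (T : Box → s) b => ofLex (T b).1) ''
        ({T ∈ fillings (fun a : s => (ofLex a.1).isLeft) B |
          ν = ∑ b ∈ B, Finsupp.single (ofLex (T b).1) 1} : Finset (Box → s)) := by
    ext T
    rw [Set.mem_ofPred_eq, forall_eq_ncard_iff]
    simp only [Set.mem_image, Finset.coe_filter, Set.mem_ofPred_eq, mem_fillings,
      isFilling_iff_isSuperSSYT hs]
    constructor
    · rintro ⟨h1, h2⟩
      have hT : ∀ b, toLex (T b) ∈ s := by
        intro b
        by_cases hb : b ∈ B
        · refine hν _ ?_
          rw [h2, Finsupp.finsetSum_apply]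
          refine (Finset.sum_pos' (fun _ _ => Nat.zero_le _) ⟨b, hb, ?_⟩).ne'
          simp
        · rw [h1.2.2.2.2 b hb, ← hs]
          exact (default : s).2
      exact ⟨fun b => ⟨toLex (T b), hT b⟩, ⟨h1, h2⟩, rfl⟩
    · rintro ⟨T, h, rfl⟩
      exact h
  change (Set.ncard _ : ℤ) = _
  rw [hset, Set.ncard_image_of_injective _ hinj, Set.ncard_coe_finset, Finset.card_filter,
    fillSum, map_sum]
  push_cast
  refine Finset.sum_congr rfl fun T _ => ?_
  simp only [MvPowerSeries.X_def]
  rw [MvPowerSeries.prod_monomial, MvPowerSeries.coeff_monomial]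
  simp

/-- Modulo truncation, supersymmetric Schur functions involve only finitely many symbols. -/
theorem exists_mk_superSchur_eq (ν : (ℕ ⊕ ℕ) →₀ ℕ) :
    ∃ (A : Type) (_ : LinearOrder A) (_ : Inhabited A) (_ : Fintype A) (X : A → Prop)
      (w : A → MvPowerSeries (ℕ ⊕ ℕ) ℤ), ∀ B : Finset Box,
        Ideal.Quotient.mk (truncIdeal ν) (superSchur B) =
          Ideal.Quotient.mk (truncIdeal ν) (fillSum X w B) := by
  set s : Finset (ℕ ⊕ₗ ℕ) := insert (toLex (Sum.inl 0)) (ν.support.map toLex.toEmbedding) with hs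
  let i : Inhabited s := ⟨⟨toLex (Sum.inl 0), Finset.mem_insert_self _ _⟩⟩
  refine ⟨s, inferInstance, i, inferInstance, fun a => (ofLex a.1).isLeft,
    fun a => MvPowerSeries.X (ofLex a.1), fun B => ?_⟩
  refine mk_truncIdeal_eq_iff.2 fun d hd => coeff_superSchur rfl B fun v hv => ?_
  have : ν v ≠ 0 := fun h => hv (Nat.le_zero.1 (h ▸ hd v))
  simp [hs, this]

end PowerSeries

section Sign

theorem invOD_eq_card {m : ℕ} {θ : Fin m → Set Box} (hθinj : Function.Injective θ)
    (hB : ∀ i, IsBorderStrip (θ i)) {pθ qθ : Fin m → ℤ}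
    (hpq : ∀ i, HasPQ (θ i) (pθ i) (qθ i)) :
    invOD (Set.range θ) =
      Finset.card {x : Fin m × Fin m | pθ x.2 < pθ x.1 ∧ qθ x.1 < qθ x.2} := by
  rw [← Set.ncard_coe_finset,
    ← Set.ncard_image_of_injective _ (hθinj.prodMap hθinj), invOD]
  congr 1
  ext ⟨a, b⟩
  simp only [Set.mem_ofPred_eq, Set.mem_image, Finset.coe_filter, Finset.mem_univ, true_and,
    Prod.exists, Prod.map_apply, Prod.mk.injEq]
  constructor
  · rintro ⟨⟨i, rfl⟩, ⟨j, rfl⟩, p₁, q₁, p₂, q₂, h1, h2, hp, hq⟩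
    obtain ⟨rfl, rfl⟩ := (hB i).hasPQ_unique h1 (hpq i)
    obtain ⟨rfl, rfl⟩ := (hB j).hasPQ_unique h2 (hpq j)
    exact ⟨i, j, ⟨hp, hq⟩, rfl, rfl⟩
  · rintro ⟨i, j, h, rfl, rfl⟩
    exact ⟨⟨i, rfl⟩, ⟨j, rfl⟩, _, _, _, _, hpq i, hpq j, h⟩

theorem sign_eq_neg_one_pow_card {m : ℕ} (σ : Equiv.Perm (Fin m)) :
    (σ.sign : ℤ) = (-1) ^ Finset.card {x : Fin m × Fin m | σ x.1 < σ x.2 ∧ x.2 < x.1} := by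
  rw [σ.sign_eq_prod_prod_Iio, Finset.prod_sigma', Finset.prod_ite, Finset.prod_const_one, one_mul,
    Finset.prod_const]
  push_cast
  congr 1
  refine Finset.card_bij (fun x _ => (x.1, x.2)) ?_ ?_ ?_
  · rintro ⟨i, j⟩ h
    simp only [Finset.mem_filter, Finset.mem_sigma, Finset.mem_univ, true_and, Finset.mem_Iio,
      not_lt] at h ⊢
    exact ⟨h.2.lt_of_ne fun he => h.1.ne' (σ.injective he), h.1⟩
  · rintro ⟨i, j⟩ - ⟨i', j'⟩ - h
    simpa using h
  · rintro ⟨i, j⟩ h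
    simp only [Finset.mem_filter, Finset.mem_univ, true_and] at h
    refine ⟨⟨i, j⟩, ?_, rfl⟩
    simp [h.2, h.1.le]

theorem neg_one_pow_invOD {m : ℕ} {θ : Fin m → Set Box} (hθinj : Function.Injective θ)
    (hB : ∀ i, IsBorderStrip (θ i)) {pθ qθ : Fin m → ℤ}
    (hpq : ∀ i, HasPQ (θ i) (pθ i) (qθ i)) (hq : StrictAnti qθ) {τ : Equiv.Perm (Fin m)}
    (hp : StrictAnti (pθ ∘ τ)) : (-1) ^ invOD (Set.range θ) = (τ.sign : ℤ) := by
  rw [← Equiv.Perm.sign_symm, sign_eq_neg_one_pow_card, invOD_eq_card hθinj hB hpq]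
  congr 2
  ext x
  have h1 := hp.lt_iff_gt (a := τ.symm x.2) (b := τ.symm x.1)
  simp only [Function.comp_apply, Equiv.apply_symm_apply] at h1
  simp [h1, hq.lt_iff_gt]

end Sign

/-- **supersymmetric Hamel–Goulden determinant.** For an outside
decomposition `Π = (θ_1, …, θ_m)` of an edgewise connected skew diagram `D`, ordered so
that the ending contents strictly decrease, with `p_1 > ⋯ > p_m` the decreasing
rearrangement of the starting contents and `φ` the cutting strip, the supersymmetric skew
Schur function satisfies `s_D(X,Y) = (-1)^{inv(Π)} · det( s_{φ[p_j, q(θ_i)]}(X,Y) )`,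
where an entry with `p_j > q(θ_i) + 1` is `0` and the empty segment gives the entry `1`. -/
theorem super_hamel_goulden
    (D : Set Box) (hD : IsSkewShape D) (hne : D.Nonempty) (hconn : EdgewiseConnected D)
    (m : ℕ) (θ : Fin m → Set Box) (hθinj : Function.Injective θ)
    (hP : IsOutsideDecomposition D (Set.range θ))
    (pθ qθ : Fin m → ℤ) (hpq : ∀ i : Fin m, HasPQ (θ i) (pθ i) (qθ i))
    (hqmono : ∀ i j : Fin m, i < j → qθ j < qθ i)
    (p : Fin m → ℤ) (hpmono : ∀ i j : Fin m, i < j → p j < p i)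
    (hperm : ∃ τ : Equiv.Perm (Fin m), p = pθ ∘ τ)
    (T : Set Box) (hT : IsCuttingStripOf D (Set.range θ) T) :
    superSchur D = (-1 : MvPowerSeries (ℕ ⊕ ℕ) ℤ) ^ invOD (Set.range θ) *
      Matrix.det (Matrix.of fun i j : Fin m =>
        if p j ≤ qθ i + 1 then superSchur (stripSegment T (p j) (qθ i)) else 0) := by
  obtain ⟨S, r, hS, hseg⟩ := hP.exists_isStripDecomposition hD hne hθinj hpq hT
  obtain ⟨τ, rfl⟩ := hperm
  have hsign : (-1 : MvPowerSeries (ℕ ⊕ ℕ) ℤ) ^ invOD (Set.range θ) = ((τ.sign : ℤ) : _) := by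
    rw [← neg_one_pow_invOD hθinj (fun i => (hP.1 _ ⟨i, rfl⟩).1) hpq
      (fun i j => hqmono i j) (fun i j => hpmono i j)]
    push_cast
    rfl
  ext ν
  refine mk_truncIdeal_eq_iff.1 ?_ ν le_rfl
  obtain ⟨A, _, _, _, X, w, key⟩ := exists_mk_superSchur_eq ν
  have hentry : ∀ i j, Ideal.Quotient.mk (truncIdeal ν)
      (if pθ j ≤ qθ i + 1 then superSchur (stripSegment T (pθ j) (qθ i)) else 0) =
        Ideal.Quotient.mk (truncIdeal ν) (segSum X w S (pθ j) (qθ i)) := by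
    intro i j
    rw [segSum_eq_ite _ _ hS.step, hseg]
    split_ifs
    · exact key _
    · rfl
  have hdet : (Matrix.of fun i j => segSum X w S (pθ (τ j)) (qθ i)).det =
      ((τ.sign : ℤ) : MvPowerSeries (ℕ ⊕ ℕ) ℤ) * fillSum X w hD.finite.toFinset := by
    rw [hS.fillSum_eq_det]
    exact Matrix.det_permute' τ (Matrix.of fun i j => segSum X w S (pθ j) (qθ i))
  have hmap : Ideal.Quotient.mk (truncIdeal ν) (Matrix.det (Matrix.of fun i j : Fin m =>
        if (pθ ∘ τ) j ≤ qθ i + 1 then superSchur (stripSegment T ((pθ ∘ τ) j) (qθ i)) else 0)) =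
      Ideal.Quotient.mk (truncIdeal ν)
        (Matrix.of fun i j => segSum X w S (pθ (τ j)) (qθ i)).det := by
    rw [RingHom.map_det, RingHom.map_det]
    congr 1
    ext i j
    exact hentry i (τ j)
  rw [map_mul, hmap, ← map_mul, hdet, hsign, ← mul_assoc, ← Int.cast_mul, ← Units.val_mul,
    Int.units_mul_self, Units.val_one, Int.cast_one, one_mul, ← key, Set.Finite.coe_toFinset]
end
end
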